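/- arXiv:2511.11862 — 4 statements merged into one kernel-verified Lean document; each statement's English description precedes it below -/
import Mathlib

section
/- Let h > 0, μ, K, C ∈ ℝ and σ > 0, and let Y ~ N(μ, σ²). Define Ψ_h(y) = (y − K)·Csinc((y − C)/(σh)) − (σ/h)·sinc((y − C)/(σh)). Then (i) the bias satisfies |E[Ψ_h(Y)] − (μ − K)·Φ((μ − C)/σ)| ≤ |μ − K| · h² · e^{−1/(2h²)} for every h > 0, and consequently (ii) lim_{h → 0} E[Ψ_h(Y)] = (μ − K)·Φ((μ − C)/σ). -/
open MeasureTheory ProbabilityTheory Filter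

/-- standard normal density -/
noncomputable def phiR (x : ℝ) : ℝ := (Real.sqrt (2 * Real.pi))⁻¹ * Real.exp (-(x ^ 2) / 2)

/-- standard normal CDF -/
noncomputable def PhiR (x : ℝ) : ℝ := ∫ t in Set.Iic x, phiR t

/-- sinc kernel, normalized by π -/
noncomputable def sincR (x : ℝ) : ℝ := if x = 0 then 1 / Real.pi else Real.sin x / (Real.pi * x)

/-- sine integral -/
noncomputable def SiR (x : ℝ) : ℝ := ∫ t in (0:ℝ)..x, Real.sin t / t

/-- cumulative sinc -/
noncomputable def CsincR (x : ℝ) : ℝ := 1 / 2 + SiR x / Real.pi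


lemma sincR_eq (x : ℝ) : sincR x = Real.sinc x / Real.pi := by
  unfold sincR
  rw [Real.sinc_apply]
  split_ifs
  · rfl
  · rw [div_div, mul_comm]

lemma SiR_eq (x : ℝ) : SiR x = ∫ t in (0:ℝ)..x, Real.sinc t := by
  unfold SiR
  apply intervalIntegral.integral_congr_ae
  have : ∀ᵐ t : ℝ, t ≠ 0 := by
    simp [ae_iff]
  filter_upwards [this] with t ht _
  rw [Real.sinc_of_ne_zero ht]

lemma SiR_mul (x a : ℝ) : SiR (x * a) = ∫ w in (0:ℝ)..a, x * Real.sinc (x * w) := by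
  rw [SiR_eq, intervalIntegral.integral_const_mul, intervalIntegral.mul_integral_comp_mul_left]
  simp

lemma SiR_hasDerivAt (x : ℝ) : HasDerivAt SiR (Real.sinc x) x := by
  have : SiR = fun x => ∫ t in (0:ℝ)..x, Real.sinc t := funext SiR_eq
  rw [this]
  exact intervalIntegral.integral_hasDerivAt_right
    (Real.continuous_sinc.intervalIntegrable _ _)
    (Real.continuous_sinc.stronglyMeasurableAtFilter _ _) Real.continuous_sinc.continuousAt

lemma SiR_abs_le (x : ℝ) : |SiR x| ≤ |x| := by
  rw [SiR_eq]
  have := intervalIntegral.norm_integral_le_of_norm_le_const (a := 0) (b := x) (C := 1)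
    (f := Real.sinc) (fun t _ => Real.abs_sinc_le_one t)
  simpa using this

lemma SiR_continuous : Continuous SiR :=
  continuous_iff_continuousAt.2 fun x => (SiR_hasDerivAt x).continuousAt

lemma D_bound (x w : ℝ) : |x * Real.sinc (x * w)| ≤ |x| := by
  rw [abs_mul]
  exact mul_le_of_le_one_right (abs_nonneg _) (Real.abs_sinc_le_one _)

lemma D_eq (x w : ℝ) (hw : w ≠ 0) : x * Real.sinc (x * w) = Real.sin (x * w) / w := by
  by_cases hx : x = 0
  · simp [hx]
  · rw [Real.sinc_of_ne_zero (mul_ne_zero hx hw)]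
    field_simp

lemma D_hasDerivAt (x w : ℝ) :
    HasDerivAt (fun x => x * Real.sinc (x * w)) (Real.cos (x * w)) x := by
  by_cases hw : w = 0
  · subst hw; simpa using hasDerivAt_id' x
  · have : (fun x => x * Real.sinc (x * w)) = fun x => Real.sin (x * w) / w :=
      funext fun x => D_eq x w hw
    rw [this]
    have := (((hasDerivAt_id' x).mul_const w).sin).div_const w
    refine this.congr_deriv ?_
    field_simp

lemma integrable_gauss_iff (c : ℝ) (f : ℝ → ℝ) :
    Integrable f (gaussianReal c 1) ↔ Integrable (fun x => gaussianPDFReal c 1 x * f x) := by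
  rw [gaussianReal_of_var_ne_zero c one_ne_zero,
    integrable_withDensity_iff_integrable_smul' (measurable_gaussianPDF _ _)
      (ae_of_all _ fun _ ↦ gaussianPDF_lt_top)]
  simp [toReal_gaussianPDF]

lemma pdf_hasDerivAt (c x : ℝ) :
    HasDerivAt (gaussianPDFReal c 1) (-(x - c) * gaussianPDFReal c 1 x) x := by
  rw [gaussianPDFReal_def]
  have h1 : HasDerivAt (fun x : ℝ => -(x - c) ^ 2 / (2 * ((1 : NNReal) : ℝ))) (-(x - c)) x := by
    have := ((((hasDerivAt_id' x).sub_const c).pow 2).neg).div_const (2 * ((1 : NNReal) : ℝ))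
    refine this.congr_deriv ?_
    simp
    try ring
  have := (h1.exp).const_mul (√(2 * Real.pi * ((1 : NNReal) : ℝ)))⁻¹
  refine this.congr_deriv ?_
  ring

lemma gauss_sq_integrable (c : ℝ) : Integrable (fun x : ℝ => x ^ 2) (gaussianReal c 1) := by
  have := (memLp_id_gaussianReal (μ := c) (v := 1) 2).integrable_sq
  simpa using this

lemma stein (c : ℝ) (g g' : ℝ → ℝ) (hg : ∀ x, HasDerivAt g (g' x) x) (hg' : Continuous g')
    (A B : ℝ) (hA : ∀ x, |g x| ≤ A + B * |x|) (hB : ∀ x, |g' x| ≤ B) :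
    Integrable g (gaussianReal c 1) ∧
    Integrable (fun x => (x - c) * g x - g' x) (gaussianReal c 1) ∧
    ∫ x, ((x - c) * g x - g' x) ∂(gaussianReal c 1) = 0 := by
  have hgc : Continuous g := continuous_iff_continuousAt.2 fun x => (hg x).continuousAt
  have h0 : Integrable (fun x : ℝ => x) (gaussianReal c 1) := by
    exact (memLp_id_gaussianReal (μ := c) (v := 1) 1).integrable (by simp)
  have hgi : Integrable g (gaussianReal c 1) := by
    refine Integrable.mono' ((integrable_const A).add (h0.abs.const_mul B))
      hgc.aestronglyMeasurable (ae_of_all _ fun x => ?_)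
    simpa using hA x
  have hBn : 0 ≤ B := (abs_nonneg _).trans (hB 0)
  have hAn : 0 ≤ A := by simpa using (abs_nonneg _).trans (hA 0)
  have hg'i : Integrable g' (gaussianReal c 1) :=
    Integrable.mono' (integrable_const B) hg'.aestronglyMeasurable (ae_of_all _ hB)
  have hxg : Integrable (fun x => (x - c) * g x) (gaussianReal c 1) := by
    refine Integrable.mono' (g := fun x => (A + B) * (x ^ 2 + 1) + |c| * |g x|) ?_
      (by fun_prop) (ae_of_all _ fun x => ?_)
    · exact (((gauss_sq_integrable c).add (integrable_const 1)).const_mul _).add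
        (hgi.abs.const_mul _)
    · rw [Real.norm_eq_abs, abs_mul]
      have h1 : |x - c| ≤ |x| + |c| := abs_sub _ _
      have h2 := hA x
      have h3 : |x| * |x| = x ^ 2 := by rw [abs_mul_abs_self]; ring
      have h4 : |x| ≤ x ^ 2 + 1 := by nlinarith [abs_nonneg x]
      have h5 : |x - c| * |g x| ≤ (|x| + |c|) * |g x| := by gcongr
      have h6 : |x| * |g x| ≤ |x| * (A + B * |x|) := by gcongr
      nlinarith
  have hi := hxg.sub hg'i
  refine ⟨hgi, hi, ?_⟩
  rw [integral_gaussianReal_eq_integral_smul one_ne_zero]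
  have hd : ∀ x, HasDerivAt (fun x => gaussianPDFReal c 1 x * g x)
      (-(gaussianPDFReal c 1 x • ((x - c) * g x - g' x))) x := by
    intro x
    refine ((pdf_hasDerivAt c x).mul (hg x)).congr_deriv ?_
    rw [smul_eq_mul]; ring
  have := integral_eq_zero_of_hasDerivAt_of_integrable hd
    ((integrable_gauss_iff c _).1 hi).neg ((integrable_gauss_iff c _).1 hgi)
  rw [integral_neg] at this
  linarith

lemma gauss_sin (c w : ℝ) :
    ∫ x, Real.sin (x * w) ∂(gaussianReal c 1) = Real.exp (-w ^ 2 / 2) * Real.sin (c * w) := by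
  have h := charFun_gaussianReal (μ := c) (v := 1) w
  rw [charFun_apply_real] at h
  have hint : Integrable (fun x : ℝ => Complex.exp (w * x * Complex.I)) (gaussianReal c 1) := by
    refine Integrable.mono' (integrable_const 1) (by fun_prop) (ae_of_all _ fun x => ?_)
    rw [← Complex.ofReal_mul, Complex.norm_exp_ofReal_mul_I]
  have h2 := congrArg Complex.im h
  rw [← RCLike.im_eq_complex_im, ← integral_im hint] at h2
  simp only [RCLike.im_eq_complex_im] at h2
  have e : ∀ x : ℝ, (Complex.exp (w * x * Complex.I)).im = Real.sin (x * w) := by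
    intro x
    rw [← Complex.ofReal_mul, Complex.exp_ofReal_mul_I_im, mul_comm]
  simp only [e] at h2
  rw [h2, Complex.exp_im]
  simp [mul_comm, ← Complex.ofReal_pow]
  left; ring_nf

lemma gauss_cos (w : ℝ) :
    ∫ x, Real.cos (w * x) ∂(gaussianReal 0 1) = Real.exp (-w ^ 2 / 2) := by
  have h := charFun_gaussianReal (μ := 0) (v := 1) w
  rw [charFun_apply_real] at h
  have hint : Integrable (fun x : ℝ => Complex.exp (w * x * Complex.I)) (gaussianReal 0 1) := by
    refine Integrable.mono' (integrable_const 1) (by fun_prop) (ae_of_all _ fun x => ?_)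
    rw [← Complex.ofReal_mul, Complex.norm_exp_ofReal_mul_I]
  have h2 := congrArg Complex.re h
  rw [← RCLike.re_eq_complex_re, ← integral_re hint] at h2
  simp only [RCLike.re_eq_complex_re] at h2
  have e : ∀ x : ℝ, (Complex.exp (w * x * Complex.I)).re = Real.cos (w * x) := by
    intro x
    rw [← Complex.ofReal_mul, Complex.exp_ofReal_mul_I_re]
  simp only [e] at h2
  rw [h2, Complex.exp_re]
  simp [← Complex.ofReal_pow]
  ring_nf

lemma gauss_D (c w : ℝ) : ∫ x, x * Real.sinc (x * w) ∂(gaussianReal c 1)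
    = Real.exp (-w ^ 2 / 2) * (c * Real.sinc (c * w)) := by
  by_cases hw : w = 0
  · subst hw; simp [integral_id_gaussianReal]
  · simp only [D_eq _ _ hw]
    rw [integral_div, gauss_sin]
    ring

lemma gauss_Si (c a : ℝ) (ha : 0 < a) : ∫ x, SiR (x * a) ∂(gaussianReal c 1)
    = ∫ w in (0:ℝ)..a, Real.exp (-w ^ 2 / 2) * (c * Real.sinc (c * w)) := by
  simp only [SiR_mul, intervalIntegral.integral_of_le ha.le]
  rw [integral_integral_swap]
  · simp only [gauss_D]
  · have h0 : Integrable (fun x : ℝ => x) (gaussianReal c 1) := by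
      exact (memLp_id_gaussianReal (μ := c) (v := 1) 1).integrable (by simp)
    have hm := h0.abs.mul_prod (ν := volume.restrict (Set.Ioc 0 a)) (integrable_const (1:ℝ))
    refine Integrable.mono' hm ?_ (ae_of_all _ fun p => ?_)
    · have := Real.continuous_sinc
      have : Continuous (Function.uncurry fun (x y : ℝ) => x * Real.sinc (x * y)) := by
        unfold Function.uncurry
        fun_prop
      exact this.aestronglyMeasurable
    · simpa [Function.uncurry] using D_bound p.1 p.2

lemma F_hasDerivAt (c : ℝ) :
    HasDerivAt (fun c => ∫ w, c * Real.sinc (c * w) ∂(gaussianReal 0 1))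
      (Real.exp (-c ^ 2 / 2)) c := by
  rw [← gauss_cos]
  have hs := Real.continuous_sinc
  refine (hasDerivAt_integral_of_dominated_loc_of_deriv_le (s := Set.univ) (bound := fun _ => 1)
    Filter.univ_mem (F' := fun c w => Real.cos (c * w)) ?_ ?_ ?_ ?_ ?_ ?_).2
  · exact Eventually.of_forall fun x => Continuous.aestronglyMeasurable (by fun_prop)
  · exact Integrable.mono' (integrable_const |c|)
      (Continuous.aestronglyMeasurable (by fun_prop)) (ae_of_all _ fun w => D_bound c w)
  · exact Continuous.aestronglyMeasurable (by fun_prop)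
  · exact ae_of_all _ fun w x _ => Real.abs_cos_le_one _
  · exact integrable_const _
  · exact ae_of_all _ fun w x _ => D_hasDerivAt x w

lemma F_eq (c : ℝ) : ∫ w, c * Real.sinc (c * w) ∂(gaussianReal 0 1)
    = ∫ t in (0:ℝ)..c, Real.exp (-t ^ 2 / 2) := by
  rw [intervalIntegral.integral_eq_sub_of_hasDerivAt (fun x _ => F_hasDerivAt x)
    (Continuous.intervalIntegrable (by fun_prop) _ _)]
  simp

lemma phi_eq : phiR = gaussianPDFReal 0 1 := by
  ext x; simp [phiR, gaussianPDFReal]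

lemma Phi_zero : PhiR 0 = 1 / 2 := by
  unfold PhiR
  have h1 := integral_comp_neg_Iic 0 phiR
  have h2 : (fun x => phiR (-x)) = phiR := by ext x; simp [phiR]
  rw [h2] at h1
  have h3 := integral_comp_abs (f := phiR)
  have h4 : (fun x => phiR |x|) = phiR := by ext x; simp [phiR]
  rw [h4, phi_eq, integral_gaussianPDFReal_eq_one _ one_ne_zero] at h3
  rw [h1, phi_eq, neg_zero]
  linarith

lemma Phi_eq (c : ℝ) : PhiR c = 1 / 2 + (√(2 * Real.pi))⁻¹ * ∫ t in (0:ℝ)..c, Real.exp (-t ^ 2 / 2) := by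
  have hi : Integrable phiR := by rw [phi_eq]; exact integrable_gaussianPDFReal _ _
  have := intervalIntegral.integral_Iic_sub_Iic (a := 0) (b := c) hi.integrableOn hi.integrableOn
  rw [← intervalIntegral.integral_const_mul, ← Phi_zero]
  change _ = PhiR 0 + ∫ x in (0:ℝ)..c, phiR x
  rw [← this]
  unfold PhiR
  ring

lemma D_integrable (c : ℝ) :
    Integrable (fun w : ℝ => Real.exp (-w ^ 2 / 2) * (c * Real.sinc (c * w))) := by
  have hs := Real.continuous_sinc
  have he : Integrable (fun w : ℝ => Real.exp (-w ^ 2 / 2)) := by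
    have := integrable_exp_neg_mul_sq (b := 1 / 2) (by norm_num)
    refine this.congr (ae_of_all _ fun x => ?_)
    simp only; congr 1; ring
  refine Integrable.mono' (he.mul_const |c|) (Continuous.aestronglyMeasurable (by fun_prop))
    (ae_of_all _ fun w => ?_)
  rw [norm_mul, Real.norm_eq_abs, Real.abs_exp]
  exact mul_le_mul_of_nonneg_left (D_bound c w) (Real.exp_pos _).le

lemma Phi_inversion (c : ℝ) : ∫ w in Set.Ioi (0:ℝ), Real.exp (-w ^ 2 / 2) * (c * Real.sinc (c * w))
    = Real.pi * (PhiR c - 1 / 2) := by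
  have h := F_eq c
  rw [integral_gaussianReal_eq_integral_smul one_ne_zero, ← phi_eq] at h
  have h3 := integral_comp_abs (f := fun w => phiR w • (c * Real.sinc (c * w)))
  have h4 : (fun w => phiR |w| • (c * Real.sinc (c * |w|)))
      = fun w => phiR w • (c * Real.sinc (c * w)) := by
    ext w
    rcases abs_choice w with hw | hw <;> rw [hw]
    simp [phiR, Real.sinc_neg]
  rw [h4, h] at h3
  have h5 : ∫ w in Set.Ioi (0:ℝ), phiR w • (c * Real.sinc (c * w)) =
    (√(2 * Real.pi))⁻¹ * ∫ w in Set.Ioi (0:ℝ), Real.exp (-w ^ 2 / 2) * (c * Real.sinc (c * w)) := by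
    rw [← integral_const_mul]
    simp only [phiR, smul_eq_mul, mul_assoc]
  rw [h5] at h3
  rw [Phi_eq, h3]
  have hp := Real.pi_pos
  have hq : √(2 * Real.pi) ^ 2 = 2 * Real.pi := Real.sq_sqrt (by positivity)
  have hq0 : √(2 * Real.pi) ≠ 0 := by positivity
  generalize √(2 * Real.pi) = s at *
  generalize (∫ w in Set.Ioi (0:ℝ), Real.exp (-w ^ 2 / 2) * (c * Real.sinc (c * w))) = J
  field_simp
  rw [hq]; ring

lemma tail (c a : ℝ) (ha : 0 < a) :
    |∫ w in Set.Ioi a, Real.exp (-w ^ 2 / 2) * (c * Real.sinc (c * w))|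
      ≤ a⁻¹ ^ 2 * Real.exp (-a ^ 2 / 2) := by
  have hd : ∀ x ∈ Set.Ici a, HasDerivAt (fun w : ℝ => -Real.exp (-w ^ 2 / 2))
      (x * Real.exp (-x ^ 2 / 2)) x := by
    intro x _
    have h1 : HasDerivAt (fun x : ℝ => -x ^ 2 / 2) (-x) x := by
      have := (((hasDerivAt_id' x).pow 2).neg).div_const 2
      refine this.congr_deriv ?_
      simp
      try ring
    refine h1.exp.neg.congr_deriv ?_
    ring
  have ht : Tendsto (fun w : ℝ => -Real.exp (-w ^ 2 / 2)) atTop (nhds 0) := by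
    rw [← neg_zero]
    refine Tendsto.neg (Real.tendsto_exp_atBot.comp ?_)
    have : Tendsto (fun w : ℝ => w ^ 2 / 2) atTop atTop :=
      (tendsto_pow_atTop two_ne_zero).atTop_div_const (by norm_num)
    refine (tendsto_neg_atTop_atBot.comp this).congr fun x => ?_
    simp [neg_div]
  have hi : IntegrableOn (fun x : ℝ => x * Real.exp (-x ^ 2 / 2)) (Set.Ioi a) :=
    integrableOn_Ioi_deriv_of_nonneg' hd (fun x hx => by
      have : 0 < x := ha.trans hx
      positivity) ht
  have hv := integral_Ioi_of_hasDerivAt_of_tendsto' hd hi ht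
  have hb := norm_integral_le_of_norm_le (μ := volume.restrict (Set.Ioi a))
    (f := fun w => Real.exp (-w ^ 2 / 2) * (c * Real.sinc (c * w)))
    (g := fun x => a⁻¹ ^ 2 * (x * Real.exp (-x ^ 2 / 2))) (hi.const_mul _) (by
      filter_upwards [ae_restrict_mem measurableSet_Ioi] with w hw
      have hw0 : 0 < w := ha.trans hw
      have haw : a < w := hw
      rw [norm_mul, Real.norm_eq_abs, Real.abs_exp, D_eq c w hw0.ne', Real.norm_eq_abs, abs_div,
        abs_of_pos hw0]
      have : |Real.sin (c * w)| / w ≤ a⁻¹ ^ 2 * w := by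
        rw [div_le_iff₀ hw0]
        refine (Real.abs_sin_le_one _).trans ?_
        have : 1 ≤ a⁻¹ * w := by rw [inv_mul_eq_div, one_le_div ha]; exact haw.le
        nlinarith
      calc _ ≤ Real.exp (-w ^ 2 / 2) * (a⁻¹ ^ 2 * w) := by gcongr
        _ = _ := by ring)
  rw [integral_const_mul, hv] at hb
  simpa using hb

lemma bias_Csinc (c a : ℝ) (ha : 0 < a) :
    |∫ x, CsincR (x * a) ∂(gaussianReal c 1) - PhiR c| ≤ a⁻¹ ^ 2 * Real.exp (-a ^ 2 / 2) := by
  have h0 : Integrable (fun x : ℝ => x) (gaussianReal c 1) := by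
    exact (memLp_id_gaussianReal (μ := c) (v := 1) 1).integrable (by simp)
  have hSi : Integrable (fun x => SiR (x * a)) (gaussianReal c 1) := by
    refine Integrable.mono' (h0.mul_const a).abs ?_ (ae_of_all _ fun x => SiR_abs_le _)
    have := SiR_continuous
    exact Continuous.aestronglyMeasurable (by fun_prop)
  have h1 : ∫ x, CsincR (x * a) ∂(gaussianReal c 1)
      = 1 / 2 + (∫ w in (0:ℝ)..a, Real.exp (-w ^ 2 / 2) * (c * Real.sinc (c * w))) / Real.pi := by
    unfold CsincR
    rw [integral_add (integrable_const _) (hSi.div_const _), integral_div Real.pi, gauss_Si c a ha]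
    simp
  have h2 := intervalIntegral.integral_Ioi_sub_Ioi (D_integrable c).integrableOn ha.le
  rw [Phi_inversion] at h2
  have hp := Real.pi_pos
  have h3 : ∫ x, CsincR (x * a) ∂(gaussianReal c 1) - PhiR c =
      -(∫ w in Set.Ioi a, Real.exp (-w ^ 2 / 2) * (c * Real.sinc (c * w))) / Real.pi := by
    rw [h1, ← h2]
    generalize (∫ w in Set.Ioi a, Real.exp (-w ^ 2 / 2) * (c * Real.sinc (c * w))) = J
    field_simp
    ring
  rw [h3, abs_div, abs_neg, abs_of_pos hp, div_le_iff₀ hp]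
  refine (tail c a ha).trans ?_
  have : 1 ≤ Real.pi := by linarith [Real.two_le_pi]
  exact le_mul_of_one_le_right (by positivity) this

lemma Csinc_hasDerivAt (a x : ℝ) :
    HasDerivAt (fun x => CsincR (x * a)) (a * sincR (x * a)) x := by
  unfold CsincR
  have h := ((SiR_hasDerivAt (x * a)).comp x ((hasDerivAt_id' x).mul_const a)).div_const Real.pi
  refine (h.const_add (1 / 2)).congr_deriv ?_
  rw [sincR_eq]; ring

lemma gauss_map (μ C σ : ℝ) (hσ : 0 < σ) :
    gaussianReal μ ((σ ^ 2).toNNReal)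
      = (gaussianReal ((μ - C) / σ) 1).map (fun x => σ * x + C) := by
  have : (fun x => σ * x + C) = (· + C) ∘ (σ * ·) := rfl
  rw [this, ← Measure.map_map (by fun_prop) (by fun_prop), gaussianReal_map_const_mul,
    gaussianReal_map_add_const]
  congr 1
  · field_simp; ring
  · ext
    simp [Real.coe_toNNReal _ (sq_nonneg σ)]

lemma mean_Psi (μ K C σ h : ℝ) (hσ : 0 < σ) (hh : 0 < h) :
    ∫ y, ((y - K) * CsincR ((y - C) / (σ * h)) - (σ / h) * sincR ((y - C) / (σ * h)))
        ∂(gaussianReal μ ((σ ^ 2).toNNReal))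
      = (μ - K) * ∫ x, CsincR (x * h⁻¹) ∂(gaussianReal ((μ - C) / σ) 1) := by
  have hs : Continuous sincR := by
    have : sincR = fun x => Real.sinc x / Real.pi := funext sincR_eq
    rw [this]
    exact Real.continuous_sinc.div_const _
  have hC : Continuous CsincR := by
    unfold CsincR
    exact continuous_const.add (SiR_continuous.div_const _)
  rw [gauss_map μ C σ hσ, integral_map (by fun_prop)
    (Continuous.aestronglyMeasurable (by fun_prop))]
  set c := (μ - C) / σ with hc
  have hp := Real.pi_pos
  have hp1 : 1 ≤ Real.pi := by linarith [Real.two_le_pi]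
  have hh' : 0 < h⁻¹ := inv_pos.2 hh
  obtain ⟨h1, h2, h3⟩ := stein c (fun x => CsincR (x * h⁻¹)) (fun x => h⁻¹ * sincR (x * h⁻¹))
    (Csinc_hasDerivAt h⁻¹) (by fun_prop) (1 / 2) h⁻¹
    (fun x => by
      unfold CsincR
      refine (abs_add_le _ _).trans ?_
      rw [abs_of_pos (by norm_num : (0:ℝ) < 1 / 2), abs_div, abs_of_pos hp]
      have := SiR_abs_le (x * h⁻¹)
      rw [abs_mul, abs_of_pos hh'] at this
      have := (div_le_self (abs_nonneg (SiR (x * h⁻¹))) hp1)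
      linarith)
    (fun x => by
      rw [abs_mul, abs_of_pos hh', sincR_eq, abs_div, abs_of_pos hp]
      have := (div_le_self (abs_nonneg (Real.sinc (x * h⁻¹))) hp1)
      exact mul_le_of_le_one_right hh'.le (this.trans (Real.abs_sinc_le_one _)))
  have e : ∀ x, (σ * x + C - K) * CsincR ((σ * x + C - C) / (σ * h))
      - (σ / h) * sincR ((σ * x + C - C) / (σ * h))
      = σ * ((x - c) * CsincR (x * h⁻¹) - h⁻¹ * sincR (x * h⁻¹))
        + (μ - K) * CsincR (x * h⁻¹) := by
    intro x
    have e1 : (σ * x + C - C) / (σ * h) = x * h⁻¹ := by field_simp; ring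
    have e2 : σ * c = μ - C := by rw [hc]; field_simp
    rw [e1]
    have e3 : C = μ - σ * c := by linarith
    rw [e3]
    ring
  simp only [e]
  rw [integral_add (h2.const_mul σ) (h1.const_mul _), integral_const_mul, integral_const_mul, h3]
  ring

/-- bias bound for the ASSURE summand and the `h → 0⁺` limit. -/
theorem assure_bias (μ K C σ : ℝ) (hσ : 0 < σ) (Ψ : ℝ → ℝ → ℝ)
    (hΨ : ∀ h y, Ψ h y =
      (y - K) * CsincR ((y - C) / (σ * h)) - (σ / h) * sincR ((y - C) / (σ * h))) :
    (∀ h : ℝ, 0 < h →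
      |(∫ y, Ψ h y ∂(gaussianReal μ ((σ ^ 2).toNNReal))) - (μ - K) * PhiR ((μ - C) / σ)|
        ≤ |μ - K| * h ^ 2 * Real.exp (-1 / (2 * h ^ 2))) ∧
    Tendsto (fun h : ℝ => ∫ y, Ψ h y ∂(gaussianReal μ ((σ ^ 2).toNNReal)))
      (nhdsWithin 0 (Set.Ioi 0)) (nhds ((μ - K) * PhiR ((μ - C) / σ))) := by
  have main : ∀ h : ℝ, 0 < h →
      |(∫ y, Ψ h y ∂(gaussianReal μ ((σ ^ 2).toNNReal))) - (μ - K) * PhiR ((μ - C) / σ)|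
        ≤ |μ - K| * h ^ 2 * Real.exp (-1 / (2 * h ^ 2)) := by
    intro h hh
    simp only [hΨ]
    rw [mean_Psi μ K C σ h hσ hh, ← mul_sub, abs_mul, mul_assoc]
    refine mul_le_mul_of_nonneg_left ?_ (abs_nonneg _)
    have := bias_Csinc ((μ - C) / σ) h⁻¹ (inv_pos.2 hh)
    rw [inv_inv] at this
    have e : -1 / (2 * h ^ 2) = -h⁻¹ ^ 2 / 2 := by field_simp
    rw [e]
    exact this
  refine ⟨main, ?_⟩
  rw [tendsto_iff_norm_sub_tendsto_zero]
  refine squeeze_zero' (Eventually.of_forall fun _ => norm_nonneg _)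
    (g := fun h : ℝ => |μ - K| * h ^ 2) ?_ ?_
  · filter_upwards [self_mem_nhdsWithin] with h hh
    refine (main h hh).trans ?_
    refine mul_le_of_le_one_right (by positivity) (Real.exp_le_one_iff.2 ?_)
    exact div_nonpos_of_nonpos_of_nonneg (by norm_num) (by positivity)
  · have : Continuous (fun h : ℝ => |μ - K| * h ^ 2) := by fun_prop
    have := (this.tendsto 0).mono_left (nhdsWithin_le_nhds (s := Set.Ioi (0:ℝ)))
    simpa using this
end

section
/- Fix K > 0 and 0 < ε < K, and set Θ = [K − ε, K + ε]. There exist c > 0 and N ∈ ℕ (depending only on K and ε) such that for every n ≥ N and every measurable decision rule a : ℕⁿ → [0,1]ⁿ, sup over μ ∈ Θⁿ of [ sup_{β ∈ ℝ} (1/n) Σ_{i=1}^n (μ_i − K) · P(Y_i ≥ β) − (1/n) Σ_{i=1}^n (μ_i − K) · E_μ[a_i(Y₁,…,Y_n)] ] ≥ c/√n, where Y₁,…,Y_n are independent with Y_i ~ Poisson(μ_i). -/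
open MeasureTheory

/-- Poisson probability mass function with mean `μ`. -/
noncomputable def poisP (μ : ℝ) (k : ℕ) : ℝ := Real.exp (-μ) * μ ^ k / (Nat.factorial k)

lemma hasSum_mul_nonneg {ι κ : Type*} {f : ι → ℝ} {g : κ → ℝ} {A B : ℝ} (hf : HasSum f A)
    (hg : HasSum g B) (f0 : ∀ i, 0 ≤ f i) (g0 : ∀ i, 0 ≤ g i) :
    HasSum (fun x : ι × κ => f x.1 * g x.2) (A * B) :=
  hf.mul hg (hf.summable.mul_of_nonneg hg.summable f0 g0)

lemma poisP_nonneg' {m : ℝ} (hm : 0 ≤ m) (k : ℕ) : 0 ≤ poisP m k := by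
  unfold poisP; positivity

lemma poisP_hasSum {m : ℝ} (hm : 0 ≤ m) : HasSum (poisP m) 1 := by
  have := ProbabilityTheory.hasSum_one_poissonMeasure ⟨m, hm⟩
  exact this

lemma prod_hasSum (f : ℕ → ℝ) (hf : ∀ k, 0 ≤ f k) (A : ℝ) (h : HasSum f A) (n : ℕ) :
    HasSum (fun y : Fin n → ℕ => ∏ j, f (y j)) (A ^ n) := by
  induction n with
  | zero => simpa using hasSum_unique (fun y : Fin 0 → ℕ => ∏ j, f (y j))
  | succ n ih =>
    rw [← (Fin.consEquiv (fun _ : Fin (n+1) => ℕ)).hasSum_iff]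
    have h2 := hasSum_mul_nonneg h ih hf (fun y => Finset.prod_nonneg fun j _ => hf _)
    rw [pow_succ']
    convert h2 using 1
    ext ⟨k, y⟩
    simp [Fin.consEquiv, Fin.prod_univ_succ]

lemma prod_hasSum' (n : ℕ) (m : Fin n → ℝ) (hm : ∀ i, 0 ≤ m i) :
    HasSum (fun y : Fin n → ℕ => ∏ j, poisP (m j) (y j)) 1 := by
  induction n with
  | zero => simpa using hasSum_unique (fun y : Fin 0 → ℕ => ∏ j, poisP (m j) (y j))
  | succ n ih =>
    rw [← (Fin.consEquiv (fun _ : Fin (n+1) => ℕ)).hasSum_iff]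
    have h2 := hasSum_mul_nonneg (poisP_hasSum (hm 0)) (ih (fun i => m i.succ) (fun i => hm _))
      (poisP_nonneg' (hm 0)) (fun y => Finset.prod_nonneg fun j _ => poisP_nonneg' (hm _) _)
    rw [mul_one] at h2
    convert h2 using 1
    ext ⟨k, y⟩
    simp [Fin.consEquiv, Fin.prod_univ_succ]

lemma tail_summable {m : ℝ} (hm : 0 ≤ m) (β : ℝ) :
    Summable (fun k : ℕ => poisP m k * (if β ≤ (k:ℝ) then 1 else 0)) := by
  refine Summable.of_nonneg_of_le (fun k => ?_) (fun k => ?_) (poisP_hasSum hm).summable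
  · have := poisP_nonneg' hm k
    split_ifs <;> simp [this]
  · have := poisP_nonneg' hm k
    split_ifs <;> simp [this]

lemma tail_mem {m : ℝ} (hm : 0 ≤ m) (β : ℝ) :
    (∑' k : ℕ, poisP m k * (if β ≤ (k:ℝ) then 1 else 0)) ∈ Set.Icc (0:ℝ) 1 := by
  constructor
  · refine tsum_nonneg fun k => ?_
    have := poisP_nonneg' hm k
    split_ifs <;> simp [this]
  · refine le_trans ?_ (poisP_hasSum hm).tsum_eq.le
    refine (tail_summable hm β).tsum_le_tsum (fun k => ?_) (poisP_hasSum hm).summable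
    have := poisP_nonneg' hm k
    split_ifs <;> simp [this]

lemma tail_tendsto {m : ℝ} (hm : 0 ≤ m) :
    Filter.Tendsto (fun N : ℕ => ∑' k : ℕ, poisP m k * (if ((N:ℕ):ℝ) ≤ (k:ℝ) then 1 else 0))
      Filter.atTop (nhds 0) := by
  have h := tendsto_tsum_of_dominated_convergence (𝓕 := Filter.atTop)
    (f := fun (N : ℕ) (k : ℕ) => poisP m k * (if ((N:ℕ):ℝ) ≤ (k:ℝ) then (1:ℝ) else 0))
    (g := fun _ => 0) (bound := poisP m) (poisP_hasSum hm).summable ?_ ?_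
  · simpa using h
  · intro k
    refine tendsto_const_nhds.congr' ?_
    filter_upwards [Filter.eventually_gt_atTop k] with N hN
    rw [if_neg]
    · simp
    · push Not; exact_mod_cast hN
  · refine Filter.Eventually.of_forall fun N k => ?_
    have := poisP_nonneg' hm k
    split_ifs <;> simp [this, abs_of_nonneg]

lemma avg_abs {n : ℕ} (hn : 0 < n) {K ε : ℝ} (hε : 0 < ε) (m t : Fin n → ℝ)
    (hm : ∀ i, m i ∈ Set.Icc (K - ε) (K + ε)) (ht : ∀ i, t i ∈ Set.Icc (0:ℝ) 1) :
    |(1 / (n:ℝ)) * ∑ i, (m i - K) * t i| ≤ ε := by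
  have hn' : (0:ℝ) < n := by exact_mod_cast hn
  have h1 : |∑ i, (m i - K) * t i| ≤ n * ε := by
    refine (Finset.abs_sum_le_sum_abs _ _).trans ?_
    have : ∑ i : Fin n, |(m i - K) * t i| ≤ ∑ i : Fin n, ε := by
      refine Finset.sum_le_sum fun i _ => ?_
      rw [abs_mul, abs_of_nonneg (ht i).1]
      have : |m i - K| ≤ ε := by
        rw [abs_le]; constructor <;> linarith [(hm i).1, (hm i).2]
      calc |m i - K| * t i ≤ ε * 1 := mul_le_mul this (ht i).2 (ht i).1 hε.le
        _ = ε := mul_one _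
    simpa using this
  rw [abs_mul, abs_of_pos (by positivity), one_div, inv_mul_le_iff₀ hn']
  exact h1

lemma wsum_summable {ι : Type*} (P F : ι → ℝ) (hP : ∀ y, 0 ≤ P y) (hs : HasSum P 1) (ε : ℝ)
    (hF : ∀ y, |F y| ≤ ε) : Summable (fun y => P y * F y) := by
  refine Summable.of_norm_bounded (hs.summable.mul_right ε) fun y => ?_
  rw [Real.norm_eq_abs, abs_mul, abs_of_nonneg (hP y)]
  exact mul_le_mul_of_nonneg_left (hF y) (hP y)

lemma wsum_lower {ι : Type*} (P F : ι → ℝ) (hP : ∀ y, 0 ≤ P y) (hs : HasSum P 1) (ε : ℝ)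
    (hF : ∀ y, |F y| ≤ ε) : -ε ≤ ∑' y, P y * F y := by
  have h := (hs.mul_right (-ε))
  rw [one_mul] at h
  rw [← h.tsum_eq]
  exact h.summable.tsum_le_tsum
    (fun y => mul_le_mul_of_nonneg_left (abs_le.1 (hF y)).1 (hP y))
    (wsum_summable P F hP hs ε hF)

lemma pointwise {p q w a l : ℝ} (hp : 0 ≤ p) (hq : 0 ≤ q) (hw : w ^ 2 = p * q)
    (ha : a ∈ Set.Icc (0:ℝ) 1) : 2 * l * w - l ^ 2 * (p + q) ≤ p * (1 - a) + q * a := by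
  have key : ∀ x y : ℝ, 0 ≤ x → 0 ≤ y → w ^ 2 = x * y → 2 * l * w ≤ x + l ^ 2 * y := by
    intro x y hx hy h
    refine le_of_abs_le (abs_le_of_sq_le_sq ?_ (by positivity))
    nlinarith [sq_nonneg (x - l ^ 2 * y)]
  obtain ⟨h0, h1⟩ := ha
  rcases le_total p q with h | h
  · nlinarith [key p q hp hq hw, mul_nonneg h0 (sub_nonneg.2 h), mul_nonneg (sq_nonneg l) hp]
  · nlinarith [key q p hq hp (by rw [hw, mul_comm]), mul_nonneg (sub_nonneg.2 h1) (sub_nonneg.2 h),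
      mul_nonneg (sq_nonneg l) hq]

lemma poisP_mul {K d g : ℝ} (hg : g ^ 2 = (K + d) * (K - d)) (k : ℕ) :
    (Real.exp (g - K) * poisP g k) ^ 2 = poisP (K + d) k * poisP (K - d) k := by
  unfold poisP
  have e : Real.exp (g - K) ^ 2 * Real.exp (-g) ^ 2 = Real.exp (-(K + d)) * Real.exp (-(K - d)) := by
    rw [← Real.exp_nat_mul, ← Real.exp_nat_mul, ← Real.exp_add, ← Real.exp_add]
    congr 1; push_cast; ring
  have e2 : (g ^ k) ^ 2 = (K + d) ^ k * (K - d) ^ k := by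
    rw [← mul_pow, ← hg, ← pow_mul, ← pow_mul, mul_comm]
  calc _ = (Real.exp (g - K) ^ 2 * Real.exp (-g) ^ 2) * (g ^ k) ^ 2 / (k.factorial : ℝ) ^ 2 := by ring
    _ = _ := by rw [e, e2]; ring

/-- Two-point bound. -/
lemma two_point {n : ℕ} (hn : 0 < n) {K ε d : ℝ} (hK : 0 < K) (hd : 0 ≤ d) (hdK : d < K)
    (hnd : n * d ^ 2 = ε ^ 2) (b : (Fin n → ℕ) → ℝ) (hb : ∀ y, b y ∈ Set.Icc (0:ℝ) 1) :
    Real.exp (-(ε ^ 2 / K)) ^ 2 / 2 ≤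
      1 - (∑' y : Fin n → ℕ, (∏ j, poisP (K + d) (y j)) * b y)
        + (∑' y : Fin n → ℕ, (∏ j, poisP (K - d) (y j)) * b y) := by
  set g := Real.sqrt ((K + d) * (K - d)) with hgdef
  have hg0 : 0 ≤ g := Real.sqrt_nonneg _
  have hg : g ^ 2 = (K + d) * (K - d) := Real.sq_sqrt (mul_nonneg (by linarith) (by linarith))
  have hgl : -(d ^ 2 / K) ≤ g - K := by
    have : K - d ^ 2 / K ≤ g := by
      apply Real.le_sqrt_of_sq_le
      have h1 : d ^ 2 / K * K = d ^ 2 := by field_simp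
      have h2 : 0 ≤ d ^ 2 / K := by positivity
      have h3 : d ^ 2 / K ≤ K := by
        rw [div_le_iff₀ hK]; nlinarith
      nlinarith
    linarith
  set P := fun y : Fin n → ℕ => ∏ j, poisP (K + d) (y j) with hPd
  set Q := fun y : Fin n → ℕ => ∏ j, poisP (K - d) (y j) with hQd
  set W := fun y : Fin n → ℕ => ∏ j, (Real.exp (g - K) * poisP g (y j)) with hWd
  have hP : HasSum P 1 := prod_hasSum' n (fun _ => K + d) (fun _ => by linarith)
  have hQ : HasSum Q 1 := prod_hasSum' n (fun _ => K - d) (fun _ => by linarith)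
  have hP0 : ∀ y, 0 ≤ P y := fun y => Finset.prod_nonneg fun j _ => poisP_nonneg' (by linarith) _
  have hQ0 : ∀ y, 0 ≤ Q y := fun y => Finset.prod_nonneg fun j _ => poisP_nonneg' (by linarith) _
  have hW : HasSum W (Real.exp (g - K) ^ n) := by
    have := (poisP_hasSum hg0).mul_left (Real.exp (g - K))
    rw [mul_one] at this
    exact prod_hasSum _ (fun k => mul_nonneg (Real.exp_pos _).le (poisP_nonneg' hg0 k)) _ this n
  have hWW : ∀ y, W y ^ 2 = P y * Q y := by
    intro y
    simp only [hWd, hPd, hQd]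
    rw [← Finset.prod_pow, ← Finset.prod_mul_distrib]
    exact Finset.prod_congr rfl fun j _ => poisP_mul hg _
  set A := Real.exp (g - K) ^ n with hA
  have hAl : Real.exp (-(ε ^ 2 / K)) ≤ A := by
    rw [hA, ← Real.exp_nat_mul]
    apply Real.exp_le_exp.2
    have : (n:ℝ) * -(d ^ 2 / K) ≤ n * (g - K) := mul_le_mul_of_nonneg_left hgl (by positivity)
    refine le_trans (le_of_eq ?_) this
    rw [← hnd]; ring
  have hbb : ∀ y, |b y| ≤ 1 := fun y => by rw [abs_of_nonneg (hb y).1]; exact (hb y).2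
  have sP := (wsum_summable P b hP0 hP 1 hbb).hasSum
  have sQ := (wsum_summable Q b hQ0 hQ 1 hbb).hasSum
  have hR := (hP.sub sP).add sQ
  have hL := (hW.mul_left (2 * (A / 2))).sub ((hP.add hQ).mul_left ((A / 2) ^ 2))
  have hle := hasSum_le (fun y => ?_) hL hR
  · have : Real.exp (-(ε ^ 2 / K)) ^ 2 ≤ A ^ 2 := pow_le_pow_left₀ (Real.exp_pos _).le hAl 2
    nlinarith
  · have := pointwise (l := A / 2) (hP0 y) (hQ0 y) (hWW y) (hb y)
    linarith

/-- √n minimax lower bound for compound selection regret with Poisson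
observations, constant cost `K`, and parameters in `Θ = [K - ε, K + ε]`. -/
theorem poisson_regret_lower_bound (K ε : ℝ) (hK : 0 < K) (hε : 0 < ε) (hεK : ε < K) :
    ∃ c : ℝ, 0 < c ∧ ∃ N : ℕ, ∀ n : ℕ, N ≤ n →
      ∀ a : (Fin n → ℕ) → Fin n → ℝ, (∀ y i, a y i ∈ Set.Icc (0:ℝ) 1) →
        c / Real.sqrt n ≤
          ⨆ μ : {μ : Fin n → ℝ // ∀ i, μ i ∈ Set.Icc (K - ε) (K + ε)},
            ((⨆ β : ℝ, (1 / (n:ℝ)) * ∑ i, (μ.1 i - K) *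
                (∑' k : ℕ, poisP (μ.1 i) k * (if β ≤ (k:ℝ) then 1 else 0)))
              - ∑' y : Fin n → ℕ, (∏ j, poisP (μ.1 j) (y j)) *
                  ((1 / (n:ℝ)) * ∑ i, (μ.1 i - K) * a y i)) := by
  refine ⟨ε * (Real.exp (-(ε ^ 2 / K)) ^ 2 / 4), by positivity, 1, ?_⟩
  intro n hn a ha
  have hn0 : 0 < n := hn
  have hn' : (0:ℝ) < n := by exact_mod_cast hn0
  have hn1 : (1:ℝ) ≤ n := by exact_mod_cast hn
  have hpos : ∀ m : {μ : Fin n → ℝ // ∀ i, μ i ∈ Set.Icc (K - ε) (K + ε)}, ∀ i, 0 ≤ m.1 i :=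
    fun m i => by linarith [(m.2 i).1]
  have hbi : ∀ m : {μ : Fin n → ℝ // ∀ i, μ i ∈ Set.Icc (K - ε) (K + ε)}, ∀ β : ℝ,
      (1 / (n:ℝ)) * ∑ i, (m.1 i - K) *
        (∑' k : ℕ, poisP (m.1 i) k * (if β ≤ (k:ℝ) then 1 else 0)) ≤ ε := fun m β =>
    (abs_le.1 (avg_abs hn0 hε m.1 _ m.2 (fun i => tail_mem (hpos m i) β))).2
  have hbdd : ∀ m : {μ : Fin n → ℝ // ∀ i, μ i ∈ Set.Icc (K - ε) (K + ε)},
      BddAbove (Set.range fun β : ℝ => (1 / (n:ℝ)) * ∑ i, (m.1 i - K) *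
        (∑' k : ℕ, poisP (m.1 i) k * (if β ≤ (k:ℝ) then 1 else 0))) := by
    intro m
    refine ⟨ε, ?_⟩
    rintro _ ⟨β, rfl⟩
    exact hbi m β
  set F := fun m : {μ : Fin n → ℝ // ∀ i, μ i ∈ Set.Icc (K - ε) (K + ε)} =>
            ((⨆ β : ℝ, (1 / (n:ℝ)) * ∑ i, (m.1 i - K) *
                (∑' k : ℕ, poisP (m.1 i) k * (if β ≤ (k:ℝ) then 1 else 0)))
              - ∑' y : Fin n → ℕ, (∏ j, poisP (m.1 j) (y j)) *
                  ((1 / (n:ℝ)) * ∑ i, (m.1 i - K) * a y i)) with hF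
  have hFb : BddAbove (Set.range F) := by
    refine ⟨ε + ε, ?_⟩
    rintro _ ⟨m, rfl⟩
    have h1 := ciSup_le (hbi m)
    have h2 := wsum_lower (fun y : Fin n → ℕ => ∏ j, poisP (m.1 j) (y j))
      (fun y => (1 / (n:ℝ)) * ∑ i, (m.1 i - K) * a y i)
      (fun y => Finset.prod_nonneg fun j _ => poisP_nonneg' (hpos m j) _)
      (prod_hasSum' n m.1 (hpos m)) ε (fun y => avg_abs hn0 hε m.1 _ m.2 (ha y))
    simp only [hF]
    linarith
  have hsq : 0 < Real.sqrt n := Real.sqrt_pos.2 hn'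
  set d := ε / Real.sqrt n with hd
  have hd0 : 0 < d := by positivity
  have hdε : d ≤ ε := div_le_self hε.le (by rw [Real.one_le_sqrt]; exact hn1)
  have hnd : n * d ^ 2 = ε ^ 2 := by
    rw [hd, div_pow, Real.sq_sqrt hn'.le]; field_simp
  have hp : ∀ i : Fin n, K + d ∈ Set.Icc (K - ε) (K + ε) := fun i => ⟨by linarith, by linarith⟩
  have hm : ∀ i : Fin n, K - d ∈ Set.Icc (K - ε) (K + ε) := fun i => ⟨by linarith, by linarith⟩
  set b := fun y : Fin n → ℕ => (1 / (n:ℝ)) * ∑ i, a y i with hbdef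
  have hb : ∀ y, b y ∈ Set.Icc (0:ℝ) 1 := by
    intro y
    constructor
    · exact mul_nonneg (by positivity) (Finset.sum_nonneg fun i _ => (ha y i).1)
    · have : ∑ i, a y i ≤ ∑ i : Fin n, (1:ℝ) := Finset.sum_le_sum fun i _ => (ha y i).2
      simp only [Finset.sum_const, Finset.card_univ, Fintype.card_fin, nsmul_eq_mul, mul_one] at this
      simp only [hbdef]
      rw [one_div, inv_mul_le_iff₀ hn']
      linarith
  have two := two_point hn0 hK hd0.le (by linarith) hnd b hb
  have f1 : d * (1 - ∑' y : Fin n → ℕ, (∏ j, poisP (K + d) (y j)) * b y)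
      ≤ F ⟨fun _ => K + d, hp⟩ := by
    have hs : d ≤ ⨆ β : ℝ, (1 / (n:ℝ)) * ∑ i : Fin n, (K + d - K) *
        (∑' k : ℕ, poisP (K + d) k * (if β ≤ (k:ℝ) then 1 else 0)) := by
      refine le_trans (le_of_eq ?_) (le_ciSup (hbdd ⟨fun _ => K + d, hp⟩) 0)
      have : ∑' k : ℕ, poisP (K + d) k * (if (0:ℝ) ≤ (k:ℝ) then 1 else 0) = 1 := by
        simp only [Nat.cast_nonneg, if_true, mul_one]
        exact (poisP_hasSum (by linarith)).tsum_eq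
      simp only [this]
      simp; field_simp
    have ht : ∑' y : Fin n → ℕ, (∏ j, poisP (K + d) (y j)) *
        ((1 / (n:ℝ)) * ∑ i, (K + d - K) * a y i)
        = d * ∑' y : Fin n → ℕ, (∏ j, poisP (K + d) (y j)) * b y := by
      rw [← tsum_mul_left]
      refine tsum_congr fun y => ?_
      rw [← Finset.mul_sum]; simp only [hbdef]; ring
    simp only [hF]
    rw [ht]; linarith
  have f2 : d * (∑' y : Fin n → ℕ, (∏ j, poisP (K - d) (y j)) * b y)
      ≤ F ⟨fun _ => K - d, hm⟩ := by
    have hs : 0 ≤ ⨆ β : ℝ, (1 / (n:ℝ)) * ∑ i : Fin n, (K - d - K) *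
        (∑' k : ℕ, poisP (K - d) k * (if β ≤ (k:ℝ) then 1 else 0)) := by
      have hT := (((tail_tendsto (m := K - d) (by linarith)).const_mul (K - d - K)).const_mul
        (n:ℝ)).const_mul (1 / (n:ℝ))
      simp only [mul_zero] at hT
      refine le_of_tendsto' hT fun M => ?_
      refine le_trans (le_of_eq ?_) (le_ciSup (hbdd ⟨fun _ => K - d, hm⟩) (M:ℝ))
      simp
    have ht : ∑' y : Fin n → ℕ, (∏ j, poisP (K - d) (y j)) *
        ((1 / (n:ℝ)) * ∑ i, (K - d - K) * a y i)
        = -d * ∑' y : Fin n → ℕ, (∏ j, poisP (K - d) (y j)) * b y := by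
      rw [← tsum_mul_left]
      refine tsum_congr fun y => ?_
      rw [← Finset.mul_sum]; simp only [hbdef]; ring
    simp only [hF]
    rw [ht]; linarith
  have g1 := f1.trans (le_ciSup hFb _)
  have g2 := f2.trans (le_ciSup hFb _)
  have h3 := mul_le_mul_of_nonneg_left two hd0.le
  have h4 : ε * (Real.exp (-(ε ^ 2 / K)) ^ 2 / 4) / Real.sqrt n
      = d * (Real.exp (-(ε ^ 2 / K)) ^ 2 / 4) := by rw [hd]; ring
  rw [h4]
  linarith
end

section
/- For μ ∈ ℝⁿ let W_μ(β) = (1/n) Σ_{i=1}^n μ_i Φ(μ_i − β), and let Θ_{n,κ,ξ} ⊆ ℝⁿ be the set of μ such that: (i) |μ_i| ≤ 1 for all i; (ii) W_μ has a global maximizer β* with W_μ(β*) > 0, and β* is the unique local (and global) maximizer of W_μ; (iii) W_μ''(β*) < −κ; and (iv) sup_{|β − β*| > κ} W_μ(β) < W_μ(β*) − ξ. Then there exist κ > 0, ξ > 0, c > 0 and N ∈ ℕ such that for all n ≥ N and every measurable decision rule a : ℝⁿ → {0,1}ⁿ, sup over μ ∈ Θ_{n,κ,ξ} of [ sup_{β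 ∈ ℝ} W_μ(β) − (1/n) Σ_{i=1}^n μ_i E_{Y ~ N(μ, I_n)}[a_i(Y₁,…,Y_n)] ] ≥ c/n. -/
open MeasureTheory ProbabilityTheory

/-- compound welfare of the threshold rule `1{Y_i ≥ β}` in the homoskedastic
unit-variance zero-cost case -/
noncomputable def Wn (n : ℕ) (μ : Fin n → ℝ) (β : ℝ) : ℝ :=
  (1 / (n:ℝ)) * ∑ i, μ i * PhiR (μ i - β)

lemma phiR_eq (x : ℝ) : phiR x = gaussianPDFReal 0 1 x := by
  simp [phiR, gaussianPDFReal]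

lemma phiR_pos (x : ℝ) : 0 < phiR x := by
  rw [phiR_eq]; exact gaussianPDFReal_pos _ _ _ (by simp)

lemma phiR_neg (x : ℝ) : phiR (-x) = phiR x := by simp [phiR]

lemma phiR_cont : Continuous phiR := by unfold phiR; fun_prop

lemma phiR_integrable : Integrable phiR := by
  have : phiR = gaussianPDFReal 0 1 := funext phiR_eq
  rw [this]; exact integrable_gaussianPDFReal _ _

lemma phiR_hasDeriv (x : ℝ) : HasDerivAt phiR (-x * phiR x) x := by
  unfold phiR
  have h : HasDerivAt (fun x : ℝ => -(x ^ 2) / 2) (-x) x := by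
    have := ((hasDerivAt_pow 2 x).neg).div_const 2
    refine this.congr_deriv ?_
    norm_num; ring
  refine ((h.exp).const_mul ((Real.sqrt (2 * Real.pi))⁻¹)).congr_deriv ?_
  ring

lemma phiR_ge {x : ℝ} (h : |x| ≤ 2) : phiR 2 ≤ phiR x := by
  unfold phiR
  have : x ^ 2 ≤ 2 ^ 2 := sq_le_sq' (by linarith [(abs_le.1 h).1]) (abs_le.1 h).2
  gcongr

lemma phiR_two_le : phiR 2 ≤ 1 := by
  unfold phiR
  have h1 : (Real.sqrt (2 * Real.pi))⁻¹ ≤ 1 := by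
    apply inv_le_one_of_one_le₀
    rw [Real.one_le_sqrt]
    linarith [Real.pi_gt_three]
  have h2 : Real.exp (-(2 ^ 2 : ℝ) / 2) ≤ 1 := by
    rw [Real.exp_le_one_iff]; norm_num
  have := Real.exp_pos (-(2 ^ 2 : ℝ) / 2)
  nlinarith [inv_nonneg.2 (Real.sqrt_nonneg (2 * Real.pi))]

lemma phiR_rel (β : ℝ) : phiR (1 + β) = phiR (1 - β) * Real.exp (-2 * β) := by
  unfold phiR
  rw [mul_assoc, ← Real.exp_add]
  congr 2; ring

lemma PhiR_hasDeriv (x : ℝ) : HasDerivAt PhiR (phiR x) x := by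
  have h : PhiR = fun y => PhiR 0 + ∫ t in (0:ℝ)..y, phiR t := by
    funext y
    have := intervalIntegral.integral_Iic_sub_Iic (f := phiR) (μ := volume) (a := 0) (b := y)
      phiR_integrable.integrableOn phiR_integrable.integrableOn
    unfold PhiR
    linarith
  rw [h]
  exact (intervalIntegral.integral_hasDerivAt_right (phiR_cont.intervalIntegrable _ _)
    (phiR_cont.stronglyMeasurableAtFilter _ _) phiR_cont.continuousAt).const_add _

lemma PhiR_eq_cdf (x : ℝ) : PhiR x = cdf (gaussianReal 0 1) x := by
  rw [cdf_eq_real, measureReal_def, gaussianReal_apply_eq_integral _ (by simp),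
    ENNReal.toReal_ofReal]
  · simp only [PhiR, phiR_eq]
  · exact integral_nonneg fun x => gaussianPDFReal_nonneg _ _ _

lemma PhiR_nonneg (x : ℝ) : 0 ≤ PhiR x := by rw [PhiR_eq_cdf]; exact cdf_nonneg _ _
lemma PhiR_le_one (x : ℝ) : PhiR x ≤ 1 := by rw [PhiR_eq_cdf]; exact cdf_le_one _ _
lemma PhiR_atBot : Filter.Tendsto PhiR Filter.atBot (nhds 0) := by
  have : PhiR = cdf (gaussianReal 0 1) := funext PhiR_eq_cdf
  rw [this]; exact tendsto_cdf_atBot _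

/-- welfare curve as a function of the mean sign -/
noncomputable def FF (δ β : ℝ) : ℝ := (1 + δ) / 2 * PhiR (1 - β) - (1 - δ) / 2 * PhiR (-1 - β)

noncomputable def DD (δ β : ℝ) : ℝ := -((1 + δ) / 2 * phiR (1 - β)) + (1 - δ) / 2 * phiR (1 + β)

lemma FF_hasDeriv (δ β : ℝ) : HasDerivAt (FF δ) (DD δ β) β := by
  unfold FF DD
  have h1 : HasDerivAt (fun β : ℝ => PhiR (1 - β)) (phiR (1 - β) * (-1)) β :=
    (PhiR_hasDeriv (1 - β)).comp β ((hasDerivAt_id β).const_sub 1)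
  have h2 : HasDerivAt (fun β : ℝ => PhiR (-1 - β)) (phiR (-1 - β) * (-1)) β :=
    (PhiR_hasDeriv (-1 - β)).comp β ((hasDerivAt_id β).const_sub (-1))
  refine ((h1.const_mul ((1 + δ) / 2)).sub (h2.const_mul ((1 - δ) / 2))).congr_deriv ?_
  have : phiR (-1 - β) = phiR (1 + β) := by rw [← phiR_neg]; congr 1; ring
  rw [this]; ring

lemma DD_hasDeriv (δ β : ℝ) : HasDerivAt (DD δ)
    (-((1 + δ) / 2 * ((1 - β) * phiR (1 - β))) - (1 - δ) / 2 * ((1 + β) * phiR (1 + β))) β := by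
  unfold DD
  have h1 : HasDerivAt (fun β : ℝ => phiR (1 - β)) (-(1 - β) * phiR (1 - β) * (-1)) β :=
    (phiR_hasDeriv (1 - β)).comp β ((hasDerivAt_id β).const_sub 1)
  have h2 : HasDerivAt (fun β : ℝ => phiR (1 + β)) (-(1 + β) * phiR (1 + β) * 1) β :=
    (phiR_hasDeriv (1 + β)).comp β ((hasDerivAt_id β).const_add 1)
  refine (((h1.const_mul ((1 + δ) / 2)).neg).add (h2.const_mul ((1 - δ) / 2))).congr_deriv ?_
  ring

lemma slope_ge {f f' : ℝ → ℝ} {a b m : ℝ} (hab : a ≤ b) (hf : ∀ x, HasDerivAt f (f' x) x)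
    (hm : ∀ x, a < x → x < b → m ≤ f' x) : m * (b - a) ≤ f b - f a := by
  rcases hab.eq_or_lt with rfl | hab
  · simp
  obtain ⟨c, hc, h⟩ := exists_hasDerivAt_eq_slope f f' hab
    (fun x _ => (hf x).continuousAt.continuousWithinAt) (fun x _ => hf x)
  have := hm c hc.1 hc.2
  rw [h, le_div_iff₀ (by linarith)] at this
  exact this

/-- the quadratic gain -/
lemma FF_gain (δ : ℝ) (hδ : |δ| ≤ 1) : FF δ 0 + phiR 2 / 4 * δ ^ 2 ≤ FF δ (-δ / 2) := by
  have hd := abs_le.1 hδ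
  have key : ∀ d x : ℝ, 0 ≤ d → d ≤ 1 → x ≤ d / 2 →
      (1 - d) / 2 * Real.exp (2 * x) ≤ 1 / 2 := by
    intro d x h0 h1 hx
    have e1 : Real.exp (2 * x) ≤ Real.exp d := Real.exp_le_exp.2 (by linarith)
    have e2 : 1 - d ≤ Real.exp (-d) := by linarith [Real.add_one_le_exp (-d)]
    have e3 : Real.exp (-d) * Real.exp d = 1 := by rw [← Real.exp_add]; simp
    have := mul_le_mul e2 e1 (Real.exp_pos _).le (Real.exp_pos _).le
    linarith
  have hp := phiR_pos 2
  rcases le_total 0 δ with h | h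
  · have h1 : phiR 2 * δ / 2 * (0 - (-δ / 2)) ≤ (fun y => - FF δ y) 0 - (fun y => - FF δ y) (-δ / 2) := by
      apply slope_ge (f' := fun y => - DD δ y) (by linarith) (fun x => (FF_hasDeriv δ x).neg)
      intro x hx1 hx2
      have k := key δ (-x) h hd.2 (by linarith)
      have hg := phiR_ge (x := 1 - x) (abs_le.2 ⟨by linarith, by linarith⟩)
      simp only [DD, phiR_rel]
      rw [show 2 * -x = -2 * x by ring] at k
      nlinarith [mul_le_mul_of_nonneg_left k (phiR_pos (1 - x)).le,
        mul_le_mul_of_nonneg_right hg h]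
    simp only at h1
    nlinarith
  · have h1 : phiR 2 * (-δ) / 2 * (-δ / 2 - 0) ≤ FF δ (-δ / 2) - FF δ 0 := by
      apply slope_ge (f' := DD δ) (by linarith) (fun x => (FF_hasDeriv δ x))
      intro x hx1 hx2
      have k := key (-δ) x (by linarith) (by linarith) (by linarith)
      have hg := phiR_ge (x := 1 + x) (abs_le.2 ⟨by linarith, by linarith⟩)
      have hr : phiR (1 - x) = phiR (1 + x) * Real.exp (2 * x) := by
        rw [phiR_rel, mul_assoc, ← Real.exp_add]; simp
      simp only [DD, hr]
      nlinarith [mul_le_mul_of_nonneg_left k (phiR_pos (1 + x)).le,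
        mul_le_mul_of_nonneg_right hg (neg_nonneg.2 h)]
    nlinarith

noncomputable def kap : ℝ := phiR 2 / 4
noncomputable def xi : ℝ := kap * (1 - Real.exp (-kap)) * (kap / 2)

lemma kap_pos : 0 < kap := by unfold kap; linarith [phiR_pos 2]
lemma kap_le : kap ≤ 1 / 4 := by unfold kap; linarith [phiR_two_le]
lemma xi_pos : 0 < xi := by
  have := kap_pos
  have h : Real.exp (-kap) < 1 := by rw [Real.exp_lt_one_iff]; linarith
  unfold xi
  have : 0 < 1 - Real.exp (-kap) := by linarith
  positivity

lemma FF_class (δ : ℝ) (hδ : |δ| ≤ 1 / 2) : ∃ βs : ℝ,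
    (∀ β, FF δ β ≤ FF δ βs) ∧ 0 < FF δ βs ∧
    (∀ β, IsLocalMax (FF δ) β → β = βs) ∧
    deriv (deriv (FF δ)) βs < -kap ∧
    (∀ β, kap < |β - βs| → FF δ β < FF δ βs - xi) := by
  have hd := abs_le.1 hδ
  have hk := kap_pos
  have hk' := kap_le
  have hkd : phiR 2 = 4 * kap := by unfold kap; ring
  have hr : 0 < (1 - δ) / (1 + δ) := div_pos (by linarith) (by linarith)
  obtain ⟨b, hb⟩ : ∃ b : ℝ, Real.exp (2 * b) = (1 - δ) / (1 + δ) :=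
    ⟨Real.log ((1 - δ) / (1 + δ)) / 2, by rw [mul_div_cancel₀ _ (by norm_num), Real.exp_log hr]⟩
  have hb' : (1 - δ) = (1 + δ) * Real.exp (2 * b) := by
    rw [hb]; field_simp [show (1 + δ) ≠ 0 by linarith]
  have e3 : (3:ℝ) ≤ Real.exp (3 / 2) := by
    have := Real.quadratic_le_exp_of_nonneg (x := 3 / 2) (by norm_num)
    linarith
  have hb1 : b ≤ 3 / 4 := by
    by_contra! h
    have : Real.exp (3 / 2) < Real.exp (2 * b) := Real.exp_lt_exp.2 (by linarith)
    nlinarith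
  have hb2 : -(3 / 4) ≤ b := by
    by_contra! h
    have h1 : Real.exp (3 / 2) < Real.exp (-(2 * b)) := Real.exp_lt_exp.2 (by linarith)
    have h2 : Real.exp (-(2 * b)) * Real.exp (2 * b) = 1 := by rw [← Real.exp_add]; simp
    have h3 : 0 < Real.exp (2 * b) := Real.exp_pos _
    nlinarith
  have hD : ∀ t, DD δ (b + t) = (1 + δ) / 2 * phiR (1 - (b + t)) * (Real.exp (-2 * t) - 1) := by
    intro t
    unfold DD
    rw [phiR_rel, hb']
    have : Real.exp (-2 * t) = Real.exp (2 * b) * Real.exp (-2 * (b + t)) := by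
      rw [← Real.exp_add]; congr 1; ring
    rw [this]; ring
  have hpos : ∀ t, 0 < (1 + δ) / 2 * phiR (1 - (b + t)) := fun t =>
    mul_pos (by linarith) (phiR_pos _)
  have hDneg : ∀ x, b < x → DD δ x < 0 := by
    intro x hx
    have := hD (x - b)
    rw [show b + (x - b) = x by ring] at this
    rw [this]
    have h1 := hpos (x - b)
    rw [show b + (x - b) = x by ring] at h1
    have : Real.exp (-2 * (x - b)) < 1 := by rw [Real.exp_lt_one_iff]; linarith
    nlinarith
  have hDpos : ∀ x, x < b → 0 < DD δ x := by
    intro x hx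
    have := hD (x - b)
    rw [show b + (x - b) = x by ring] at this
    rw [this]
    have h1 := hpos (x - b)
    rw [show b + (x - b) = x by ring] at h1
    have : 1 < Real.exp (-2 * (x - b)) := by rw [Real.one_lt_exp_iff]; linarith
    nlinarith
  have hcont : Continuous (FF δ) :=
    continuous_iff_continuousAt.2 fun x => (FF_hasDeriv δ x).continuousAt
  have hderiv : deriv (FF δ) = DD δ := funext fun x => (FF_hasDeriv δ x).deriv
  have hanti : StrictAntiOn (FF δ) (Set.Ici b) := by
    apply strictAntiOn_of_deriv_neg (convex_Ici b) hcont.continuousOn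
    intro x hx
    rw [interior_Ici] at hx
    rw [hderiv]; exact hDneg x hx
  have hmono : StrictMonoOn (FF δ) (Set.Iic b) := by
    apply strictMonoOn_of_deriv_pos (convex_Iic b) hcont.continuousOn
    intro x hx
    rw [interior_Iic] at hx
    rw [hderiv]; exact hDpos x hx
  have hexp1 : Real.exp (-kap) < 1 := by rw [Real.exp_lt_one_iff]; linarith
  refine ⟨b, ?_, ?_, ?_, ?_, ?_⟩
  · intro x
    rcases le_total b x with h | h
    · exact hanti.antitoneOn (Set.mem_Ici.2 le_rfl) h h
    · exact hmono.monotoneOn h (Set.mem_Iic.2 le_rfl) h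
  · have hlim : Filter.Tendsto (FF δ) Filter.atTop (nhds 0) := by
      have t1 : Filter.Tendsto (fun β : ℝ => PhiR (1 - β)) Filter.atTop (nhds 0) :=
        PhiR_atBot.comp (Filter.tendsto_atBot_add_const_left _ 1 Filter.tendsto_neg_atTop_atBot)
      have t2 : Filter.Tendsto (fun β : ℝ => PhiR (-1 - β)) Filter.atTop (nhds 0) :=
        PhiR_atBot.comp (Filter.tendsto_atBot_add_const_left _ (-1) Filter.tendsto_neg_atTop_atBot)
      have := (t1.const_mul ((1 + δ) / 2)).sub (t2.const_mul ((1 - δ) / 2))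
      rw [mul_zero, mul_zero, sub_zero] at this
      exact this
    have h1 : FF δ (b + 1) < FF δ b :=
      hanti (Set.mem_Ici.2 le_rfl) (Set.mem_Ici.2 (by linarith)) (by linarith)
    have h2 : 0 ≤ FF δ (b + 1) := by
      apply le_of_tendsto hlim
      filter_upwards [Filter.eventually_ge_atTop (b + 1)] with x hx
      exact hanti.antitoneOn (Set.mem_Ici.2 (by linarith)) (Set.mem_Ici.2 (by linarith)) hx
    linarith
  · intro x hx
    have h0 := hx.deriv_eq_zero
    rw [hderiv] at h0
    rcases lt_trichotomy x b with h | h | h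
    · linarith [hDpos x h]
    · exact h
    · linarith [hDneg x h]
  · rw [hderiv, (DD_hasDeriv δ b).deriv]
    have h0 := hD 0
    simp only [add_zero, mul_zero, Real.exp_zero, sub_self] at h0
    unfold DD at h0
    have hg := phiR_ge (x := 1 - b) (abs_le.2 ⟨by linarith, by linarith⟩)
    have : (1 - δ) / 2 * ((1 + b) * phiR (1 + b)) = (1 + b) * ((1 + δ) / 2 * phiR (1 - b)) := by
      linear_combination (1 + b) * h0
    rw [this]
    nlinarith
  · intro x hx
    rcases lt_abs.1 hx with h | h
    · have h1 : FF δ x ≤ FF δ (b + kap) :=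
        hanti.antitoneOn (Set.mem_Ici.2 (by linarith)) (Set.mem_Ici.2 (by linarith)) (by linarith)
      have h2 : FF δ (b + kap / 2) < FF δ b :=
        hanti (Set.mem_Ici.2 le_rfl) (Set.mem_Ici.2 (by linarith)) (by linarith)
      have h3 : kap * (1 - Real.exp (-kap)) * ((b + kap) - (b + kap / 2)) ≤
          (fun y => - FF δ y) (b + kap) - (fun y => - FF δ y) (b + kap / 2) := by
        apply slope_ge (f' := fun y => - DD δ y) (by linarith) (fun x => (FF_hasDeriv δ x).neg)
        intro y hy1 hy2
        have e := hD (y - b)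
        rw [show b + (y - b) = y by ring] at e
        have hg := phiR_ge (x := 1 - y) (abs_le.2 ⟨by linarith, by linarith⟩)
        have e1 : Real.exp (-2 * (y - b)) ≤ Real.exp (-kap) := Real.exp_le_exp.2 (by linarith)
        simp only [e]
        have e4 : kap ≤ (1 + δ) / 2 * phiR (1 - y) := by nlinarith
        nlinarith
      simp only at h3
      rw [show (b + kap) - (b + kap / 2) = kap / 2 by ring] at h3
      unfold xi
      linarith
    · have h1 : FF δ x ≤ FF δ (b - kap) :=
        hmono.monotoneOn (Set.mem_Iic.2 (by linarith)) (Set.mem_Iic.2 (by linarith)) (by linarith)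
      have h2 : FF δ (b - kap / 2) < FF δ b :=
        hmono (Set.mem_Iic.2 (by linarith)) (Set.mem_Iic.2 le_rfl) (by linarith)
      have h3 : kap * (1 - Real.exp (-kap)) * ((b - kap / 2) - (b - kap)) ≤
          FF δ (b - kap / 2) - FF δ (b - kap) := by
        apply slope_ge (f' := DD δ) (by linarith) (FF_hasDeriv δ)
        intro y hy1 hy2
        have e := hD (y - b)
        rw [show b + (y - b) = y by ring] at e
        have hg := phiR_ge (x := 1 - y) (abs_le.2 ⟨by linarith, by linarith⟩)
        have e1 : 1 + kap ≤ Real.exp (-2 * (y - b)) := by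
          have := Real.add_one_le_exp (-2 * (y - b)); linarith
        have e2 := Real.add_one_le_exp (-kap)
        rw [e]
        have e4 : kap ≤ (1 + δ) / 2 * phiR (1 - y) := by nlinarith
        nlinarith
      rw [show (b - kap / 2) - (b - kap) = kap / 2 by ring] at h3
      unfold xi
      linarith

lemma two_point_s4 (g : ℝ → ℝ) (hg : Measurable g) (h0 : ∀ x, 0 ≤ g x) (h1 : ∀ x, g x ≤ 1) :
    ∫ x, g x ∂(gaussianReal 1 1) - ∫ x, g x ∂(gaussianReal (-1) 1) ≤ PhiR 1 - PhiR (-1) := by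
  rw [integral_gaussianReal_eq_integral_smul (by simp),
    integral_gaussianReal_eq_integral_smul (by simp)]
  have hpdf : ∀ c x : ℝ, gaussianPDFReal c 1 x = phiR (c - x) := by
    intro c x
    simp only [gaussianPDFReal, phiR, NNReal.coe_one, mul_one]
    congr 3; ring
  simp only [hpdf, smul_eq_mul]
  have hint : ∀ c : ℝ, Integrable (fun x => phiR (c - x)) := fun c =>
    phiR_integrable.comp_sub_left c
  have hintg : ∀ c : ℝ, Integrable (fun x => phiR (c - x) * g x) := fun c =>
    (hint c).mul_bdd (c := 1) hg.aestronglyMeasurable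
      (Filter.Eventually.of_forall fun x => by
        rw [Real.norm_eq_abs, abs_of_nonneg (h0 x)]; exact h1 x)
  have hinti : ∀ c : ℝ, Integrable (fun x => (Set.Iic c).indicator phiR (c - x)) := fun c =>
    (phiR_integrable.indicator measurableSet_Iic).comp_sub_left c
  have hPhi : ∀ c : ℝ, PhiR c = ∫ x, (Set.Iic c).indicator phiR (c - x) := by
    intro c
    rw [integral_sub_left_eq_self (fun x => (Set.Iic c).indicator phiR x) volume c,
      integral_indicator measurableSet_Iic]
    rfl
  rw [hPhi 1, hPhi (-1), ← integral_sub (hintg _) (hintg _), ← integral_sub (hinti _) (hinti _)]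
  apply integral_mono ((hintg _).sub (hintg _)) ((hinti _).sub (hinti _))
  intro x
  have hr : phiR (-1 - x) = phiR (1 - x) * Real.exp (-2 * x) := by
    rw [← phiR_rel, ← phiR_neg]; congr 1; ring
  have hp := phiR_pos (1 - x)
  simp only [Pi.sub_apply, Set.indicator, Set.mem_Iic]
  by_cases hx : 0 ≤ x
  · rw [if_pos (by linarith), if_pos (by linarith), hr]
    have : Real.exp (-2 * x) ≤ 1 := by rw [Real.exp_le_one_iff]; linarith
    nlinarith [mul_nonneg (mul_nonneg hp.le (sub_nonneg.2 this)) (sub_nonneg.2 (h1 x))]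
  · push Not at hx
    rw [if_neg (by linarith), if_neg (by linarith), hr]
    have : 1 ≤ Real.exp (-2 * x) := by rw [Real.one_le_exp_iff]; linarith
    nlinarith [mul_nonneg (mul_nonneg hp.le (sub_nonneg.2 this)) (h0 x)]

lemma integrable_of_unit {α : Type*} [MeasurableSpace α] (P : Measure α) [IsFiniteMeasure P]
    (f : α → ℝ) (hf : Measurable f) (h0 : ∀ x, 0 ≤ f x) (h1 : ∀ x, f x ≤ 1) :
    Integrable f P :=
  Integrable.of_bound hf.aestronglyMeasurable 1
    (Filter.Eventually.of_forall fun x => by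
        rw [Real.norm_eq_abs, abs_of_nonneg (h0 x)]; exact h1 x)

lemma unit_integral {α : Type*} [MeasurableSpace α] (P : Measure α) [IsProbabilityMeasure P]
    (f : α → ℝ) (hf : Measurable f) (h0 : ∀ x, 0 ≤ f x) (h1 : ∀ x, f x ≤ 1) :
    ∫ x, f x ∂P ≤ 1 := by
  have := integral_mono (integrable_of_unit P f hf h0 h1) (integrable_const (1:ℝ)) h1
  simpa using this

lemma pi_split (m : ℕ) (i : Fin (m + 1)) (f : (Fin (m + 1) → ℝ) → ℝ) (hf : Measurable f)
    (h0 : ∀ x, 0 ≤ f x) (h1 : ∀ x, f x ≤ 1) (μ : Fin (m + 1) → ℝ) :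
    ∫ y, f y ∂(Measure.pi fun j => gaussianReal (μ j) 1) =
    ∫ x, (∫ z, f ((MeasurableEquiv.piFinSuccAbove (fun _ => ℝ) i).symm (x, z))
      ∂(Measure.pi fun j => gaussianReal (μ (i.succAbove j)) 1)) ∂(gaussianReal (μ i) 1) := by
  have mp := (measurePreserving_piFinSuccAbove (fun j => gaussianReal (μ j) 1) i).symm
  rw [← mp.integral_comp', integral_prod]
  exact integrable_of_unit _ _ (hf.comp (MeasurableEquiv.measurable _)) (fun _ => h0 _)
    (fun _ => h1 _)

lemma bayes_one (n : ℕ) (i : Fin n) (f : (Fin n → ℝ) → ℝ) (hf : Measurable f)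
    (h0 : ∀ x, 0 ≤ f x) (h1 : ∀ x, f x ≤ 1) (μ ν : Fin n → ℝ) (hμ : μ i = 1) (hν : ν i = -1)
    (hμν : ∀ j, j ≠ i → μ j = ν j) :
    ∫ y, f y ∂(Measure.pi fun j => gaussianReal (μ j) 1) -
    ∫ y, f y ∂(Measure.pi fun j => gaussianReal (ν j) 1) ≤ PhiR 1 - PhiR (-1) := by
  obtain ⟨m, rfl⟩ : ∃ m, n = m + 1 := ⟨n - 1, by have := i.2; omega⟩
  rw [pi_split m i f hf h0 h1 μ, pi_split m i f hf h0 h1 ν, hμ, hν]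
  have : ∀ j, ν (i.succAbove j) = μ (i.succAbove j) := fun j =>
    (hμν _ (Fin.succAbove_ne i j)).symm
  simp only [this]
  have hm : Measurable fun p : ℝ × (Fin m → ℝ) =>
      f ((MeasurableEquiv.piFinSuccAbove (fun _ => ℝ) i).symm p) :=
    hf.comp (MeasurableEquiv.measurable _)
  apply two_point_s4
  · exact (hm.stronglyMeasurable.integral_prod_right').measurable
  · intro x; exact integral_nonneg fun z => h0 _
  · intro x
    exact unit_integral _ _ (hm.comp (by fun_prop)) (fun _ => h0 _) (fun _ => h1 _)

noncomputable def sg (b : Bool) : ℝ := if b then 1 else -1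

def flp {n : ℕ} (i : Fin n) (e : Fin n → Bool) : Fin n → Bool := Function.update e i (!(e i))

lemma flp_inv {n : ℕ} (i : Fin n) : Function.Involutive (flp i) := by
  intro e; simp [flp]

lemma sum_flp {n : ℕ} (i : Fin n) (G : (Fin n → Bool) → ℝ) : ∑ e, G (flp i e) = ∑ e, G e :=
  Equiv.sum_comp (flp_inv i).toPerm G

lemma sg_flp {n : ℕ} (i : Fin n) (e : Fin n → Bool) : sg (flp i e i) = - sg (e i) := by
  cases h : e i <;> simp [flp, sg, h]

lemma sg_flp_ne {n : ℕ} (i j : Fin n) (h : j ≠ i) (e : Fin n → Bool) :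
    sg (flp i e j) = sg (e j) := by
  simp [flp, h]

lemma sum_sg {n : ℕ} (i : Fin n) : ∑ e : Fin n → Bool, sg (e i) = 0 := by
  have := sum_flp i (fun e => sg (e i))
  simp only [sg_flp, Finset.sum_neg_distrib] at this
  linarith

lemma sum_sg_sg {n : ℕ} (i j : Fin n) :
    ∑ e : Fin n → Bool, sg (e i) * sg (e j) = if i = j then 2 ^ n else 0 := by
  split_ifs with h
  · subst h
    have : ∀ b, sg b * sg b = 1 := by intro b; cases b <;> simp [sg]
    simp [this]
  · have := sum_flp i (fun e => sg (e i) * sg (e j))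
    simp only [sg_flp, sg_flp_ne i j (Ne.symm h), neg_mul, Finset.sum_neg_distrib] at this
    linarith

noncomputable def dl {n : ℕ} (e : Fin n → Bool) : ℝ := (1 / (n:ℝ)) * ∑ i, sg (e i)

lemma sg_abs (b : Bool) : |sg b| = 1 := by cases b <;> simp [sg]

lemma dl_abs {n : ℕ} (hn : 0 < n) (e : Fin n → Bool) : |dl e| ≤ 1 := by
  have hn' : (0:ℝ) < n := by exact_mod_cast hn
  unfold dl
  rw [abs_mul, abs_of_pos (by positivity)]
  have : |∑ i, sg (e i)| ≤ n := by
    refine (Finset.abs_sum_le_sum_abs _ _).trans ?_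
    simp [sg_abs]
  calc 1 / (n:ℝ) * |∑ i, sg (e i)| ≤ 1 / (n:ℝ) * n := by gcongr
    _ = 1 := by field_simp

lemma sum_dl {n : ℕ} : ∑ e : Fin n → Bool, dl e = 0 := by
  unfold dl
  rw [← Finset.mul_sum, Finset.sum_comm]
  simp [sum_sg]

lemma sum_dl_sq {n : ℕ} (hn : 0 < n) : ∑ e : Fin n → Bool, dl e ^ 2 = 2 ^ n / n := by
  have hn' : (0:ℝ) < n := by exact_mod_cast hn
  have : ∀ e : Fin n → Bool, dl e ^ 2 = (1 / (n:ℝ)) ^ 2 * ∑ i, ∑ j, sg (e i) * sg (e j) := by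
    intro e
    unfold dl
    rw [mul_pow, sq (∑ i, sg (e i)), Finset.sum_mul_sum]
  simp only [this]
  rw [← Finset.mul_sum, Finset.sum_comm]
  have h2 : ∀ i : Fin n, ∑ e : Fin n → Bool, ∑ j, sg (e i) * sg (e j) = 2 ^ n := by
    intro i
    rw [Finset.sum_comm]
    simp [sum_sg_sg]
  simp only [h2]
  simp
  field_simp

lemma mgf_sum {n : ℕ} (s : ℝ) :
    ∑ e : Fin n → Bool, Real.exp (s * ∑ i, sg (e i)) = (2 * Real.cosh s) ^ n := by
  have h := Finset.prod_univ_sum (fun _ : Fin n => (Finset.univ : Finset Bool))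
    (fun _ b => Real.exp (s * sg b))
  rw [Fintype.piFinset_univ] at h
  have h2 : ∀ e : Fin n → Bool, Real.exp (s * ∑ i, sg (e i)) = ∏ i, Real.exp (s * sg (e i)) := by
    intro e; rw [Finset.mul_sum, Real.exp_sum]
  simp only [h2]
  rw [← h]
  simp [sg, Real.cosh_eq]
  congr 1; ring

lemma bad_count {n : ℕ} (hn : 0 < n) :
    (((Finset.univ.filter fun e : Fin n → Bool => ¬ |dl e| ≤ 1 / 2).card : ℕ) : ℝ) ≤
      2 ^ n * (2 * Real.exp (-(n:ℝ) / 8)) := by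
  have hn' : (0:ℝ) < n := by exact_mod_cast hn
  have h1 : (((Finset.univ.filter fun e : Fin n → Bool => ¬ |dl e| ≤ 1 / 2).card : ℕ) : ℝ) ≤
      ∑ e : Fin n → Bool, Real.exp (-(n:ℝ) / 4) * (Real.exp (1 / 2 * ∑ i, sg (e i))
        + Real.exp (-(1 / 2) * ∑ i, sg (e i))) := by
    rw [Finset.card_filter]
    push_cast
    apply Finset.sum_le_sum
    intro e _
    rw [mul_add, ← Real.exp_add, ← Real.exp_add]
    split_ifs with h
    · positivity
    · push Not at h
      have hs : ∑ i, sg (e i) = n * dl e := by unfold dl; field_simp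
      rw [hs]
      rcases lt_abs.1 h with h | h
      · have : 1 ≤ Real.exp (-(n:ℝ) / 4 + 1 / 2 * (n * dl e)) := by
          rw [Real.one_le_exp_iff]; nlinarith
        linarith [Real.exp_pos (-(n:ℝ) / 4 + -(1 / 2) * (n * dl e))]
      · have : 1 ≤ Real.exp (-(n:ℝ) / 4 + -(1 / 2) * (n * dl e)) := by
          rw [Real.one_le_exp_iff]; nlinarith
        linarith [Real.exp_pos (-(n:ℝ) / 4 + 1 / 2 * (n * dl e))]
  refine h1.trans ?_
  rw [← Finset.mul_sum, Finset.sum_add_distrib, mgf_sum, mgf_sum, Real.cosh_neg]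
  have hc : Real.cosh (1 / 2) ≤ Real.exp (1 / 8) := by
    refine (Real.cosh_le_exp_half_sq _).trans (le_of_eq ?_)
    norm_num
  have hc2 : Real.cosh (1 / 2) ^ n ≤ Real.exp (n / 8) := by
    have := pow_le_pow_left₀ (Real.cosh_pos _).le hc n
    rw [← Real.exp_nat_mul] at this
    rwa [show (n:ℝ) * (1 / 8) = n / 8 by ring] at this
  have he : Real.exp (-(n:ℝ) / 4) * Real.exp (n / 8) = Real.exp (-(n:ℝ) / 8) := by
    rw [← Real.exp_add]; congr 1; ring
  rw [mul_pow, ← he]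
  have := Real.exp_pos (-(n:ℝ) / 4)
  have h2 : (0:ℝ) < 2 ^ n := by positivity
  calc _ = 2 * (Real.exp (-(n:ℝ) / 4) * 2 ^ n) * Real.cosh (1 / 2) ^ n := by ring
    _ ≤ 2 * (Real.exp (-(n:ℝ) / 4) * 2 ^ n) * Real.exp (n / 8) := by gcongr
    _ = _ := by ring

lemma Wn_sg {n : ℕ} (hn : 0 < n) (e : Fin n → Bool) :
    Wn n (fun i => sg (e i)) = FF (dl e) := by
  have hn' : (n:ℝ) ≠ 0 := by exact_mod_cast hn.ne'
  funext β
  have h : ∀ b, sg b * PhiR (sg b - β) = (PhiR (1 - β) - PhiR (-1 - β)) / 2 +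
      sg b * ((PhiR (1 - β) + PhiR (-1 - β)) / 2) := by
    intro b; cases b <;> simp [sg] <;> ring
  unfold Wn
  simp only [h]
  rw [Finset.sum_add_distrib, ← Finset.sum_mul]
  have hs : ∑ i, sg (e i) = n * dl e := by unfold dl; field_simp
  rw [hs]
  simp [FF]
  field_simp
  ring

lemma Wn_le {n : ℕ} (μ : Fin n → ℝ) (hμ : ∀ i, |μ i| ≤ 1) (β : ℝ) : Wn n μ β ≤ 1 := by
  unfold Wn
  rcases Nat.eq_zero_or_pos n with rfl | hn
  · simp
  have hn' : (0:ℝ) < n := by exact_mod_cast hn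
  have : ∑ i, μ i * PhiR (μ i - β) ≤ ∑ _i : Fin n, (1:ℝ) := by
    apply Finset.sum_le_sum
    intro i _
    have := (abs_le.1 (hμ i)).2
    nlinarith [PhiR_nonneg (μ i - β), PhiR_le_one (μ i - β)]
  simp at this
  rw [one_div, inv_mul_le_iff₀ hn']
  linarith

lemma pay_eq {n : ℕ} (a : (Fin n → ℝ) → Fin n → ℝ) (ha : Measurable a)
    (h01 : ∀ y i, a y i = 0 ∨ a y i = 1) (μ : Fin n → ℝ) :
    ∫ y, (1 / (n:ℝ)) * ∑ i, μ i * a y i ∂(Measure.pi fun i => gaussianReal (μ i) 1) =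
    (1 / (n:ℝ)) * ∑ i, μ i * ∫ y, a y i ∂(Measure.pi fun i => gaussianReal (μ i) 1) := by
  have h0 : ∀ i y, 0 ≤ a y i := fun i y => by rcases h01 y i with h | h <;> simp [h]
  have h1 : ∀ i y, a y i ≤ 1 := fun i y => by rcases h01 y i with h | h <;> simp [h]
  have hm : ∀ i, Measurable fun y => a y i := fun i => (measurable_pi_apply i).comp ha
  rw [integral_const_mul, integral_finsetSum]
  · simp only [integral_const_mul]
  · intro i _
    exact (integrable_of_unit _ _ (hm i) (h0 i) (h1 i)).const_mul _

lemma pay_ge {n : ℕ} (a : (Fin n → ℝ) → Fin n → ℝ) (ha : Measurable a)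
    (h01 : ∀ y i, a y i = 0 ∨ a y i = 1) (μ : Fin n → ℝ) (hμ : ∀ i, |μ i| ≤ 1) :
    -1 ≤ ∫ y, (1 / (n:ℝ)) * ∑ i, μ i * a y i ∂(Measure.pi fun i => gaussianReal (μ i) 1) := by
  have h0 : ∀ i y, 0 ≤ a y i := fun i y => by rcases h01 y i with h | h <;> simp [h]
  have h1 : ∀ i y, a y i ≤ 1 := fun i y => by rcases h01 y i with h | h <;> simp [h]
  have hm : ∀ i, Measurable fun y => a y i := fun i => (measurable_pi_apply i).comp ha
  rw [pay_eq a ha h01]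
  rcases Nat.eq_zero_or_pos n with rfl | hn
  · simp
  have hn' : (0:ℝ) < n := by exact_mod_cast hn
  have : ∑ _i : Fin n, (-1:ℝ) ≤
      ∑ i, μ i * ∫ y, a y i ∂(Measure.pi fun i => gaussianReal (μ i) 1) := by
    apply Finset.sum_le_sum
    intro i _
    have e1 := (abs_le.1 (hμ i)).1
    have e2 := unit_integral (Measure.pi fun i => gaussianReal (μ i) 1) _ (hm i) (h0 i) (h1 i)
    have e3 : 0 ≤ ∫ y, a y i ∂(Measure.pi fun i => gaussianReal (μ i) 1) :=
      integral_nonneg (h0 i)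
    nlinarith
  simp at this
  rw [one_div, le_inv_mul_iff₀ hn']
  linarith

lemma bayes_sum {n : ℕ} (hn : 0 < n) (a : (Fin n → ℝ) → Fin n → ℝ) (ha : Measurable a)
    (h01 : ∀ y i, a y i = 0 ∨ a y i = 1) :
    ∑ e : Fin n → Bool, ∫ y, (1 / (n:ℝ)) * ∑ i, sg (e i) * a y i
      ∂(Measure.pi fun i => gaussianReal (sg (e i)) 1) ≤ 2 ^ n * ((PhiR 1 - PhiR (-1)) / 2) := by
  have hn' : (0:ℝ) < n := by exact_mod_cast hn
  have h0 : ∀ i y, 0 ≤ a y i := fun i y => by rcases h01 y i with h | h <;> simp [h]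
  have h1 : ∀ i y, a y i ≤ 1 := fun i y => by rcases h01 y i with h | h <;> simp [h]
  have hm : ∀ i, Measurable fun y => a y i := fun i => (measurable_pi_apply i).comp ha
  have key : ∀ e : Fin n → Bool, _ := fun e => pay_eq a ha h01 (fun i => sg (e i))
  simp only [key]
  rw [← Finset.mul_sum, Finset.sum_comm]
  have hi : ∀ i : Fin n, ∑ e : Fin n → Bool, sg (e i) *
      ∫ y, a y i ∂(Measure.pi fun j => gaussianReal (sg (e j)) 1) ≤
      2 ^ n * ((PhiR 1 - PhiR (-1)) / 2) := by
    intro i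
    set E : (Fin n → Bool) → ℝ :=
      fun e => ∫ y, a y i ∂(Measure.pi fun j => gaussianReal (sg (e j)) 1) with hE
    have hs := sum_flp i (fun e => sg (e i) * E e)
    simp only [sg_flp] at hs
    have hle : ∑ e : Fin n → Bool, (sg (e i) * E e + - sg (e i) * E (flp i e)) ≤
        ∑ _e : Fin n → Bool, (PhiR 1 - PhiR (-1)) := by
      apply Finset.sum_le_sum
      intro e _
      cases h : e i
      · have := bayes_one n i (fun y => a y i) (hm i) (h0 i) (h1 i)
          (fun j => sg (flp i e j)) (fun j => sg (e j)) (by rw [sg_flp, h]; simp [sg])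
          (by simp [h, sg]) (fun j hj => sg_flp_ne i j hj e)
        simp only [sg, hE] at this ⊢
        simp at this ⊢
        linarith
      · have := bayes_one n i (fun y => a y i) (hm i) (h0 i) (h1 i)
          (fun j => sg (e j)) (fun j => sg (flp i e j)) (by simp [h, sg])
          (by rw [sg_flp, h]; simp [sg]) (fun j hj => (sg_flp_ne i j hj e).symm)
        simp only [sg, hE] at this ⊢
        simp at this ⊢
        linarith
    rw [Finset.sum_add_distrib, hs] at hle
    simp at hle
    linarith
  have := Finset.sum_le_sum (fun i (_ : i ∈ Finset.univ) => hi i)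
  simp only [Finset.sum_const, Finset.card_univ, Fintype.card_fin, nsmul_eq_mul] at this
  rw [one_div, inv_mul_le_iff₀ hn']
  exact this

/-- `1/n` minimax lower bound for compound selection regret over the
well-behaved parameter class `Θ_{n,κ,ξ}`. -/
theorem fast_rate_lower_bound :
    ∃ κ : ℝ, 0 < κ ∧ ∃ ξ : ℝ, 0 < ξ ∧ ∃ c : ℝ, 0 < c ∧ ∃ N : ℕ,
      ∀ n : ℕ, N ≤ n →
        ∀ a : (Fin n → ℝ) → Fin n → ℝ,
          Measurable a → (∀ y i, a y i = 0 ∨ a y i = 1) →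
          c / (n : ℝ) ≤
            ⨆ μ : {μ : Fin n → ℝ //
                (∀ i, |μ i| ≤ 1) ∧
                ∃ βs : ℝ,
                  (∀ β, Wn n μ β ≤ Wn n μ βs) ∧ 0 < Wn n μ βs ∧
                  (∀ β, IsLocalMax (Wn n μ) β → β = βs) ∧
                  deriv (deriv (Wn n μ)) βs < -κ ∧
                  (∀ β, κ < |β - βs| → Wn n μ β < Wn n μ βs - ξ)},
              ((⨆ β : ℝ, Wn n μ.1 β)
                - ∫ y, (1 / (n:ℝ)) * ∑ i, μ.1 i * a y i
                    ∂(Measure.pi fun i => gaussianReal (μ.1 i) 1)) := by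
  have hlim : Filter.Tendsto (fun n : ℕ => (n:ℝ) * Real.exp (-(n:ℝ) / 8)) Filter.atTop (nhds 0) := by
    have h := Real.tendsto_pow_mul_exp_neg_atTop_nhds_zero 1
    have h2 : Filter.Tendsto (fun n : ℕ => (n:ℝ) / 8) Filter.atTop Filter.atTop :=
      tendsto_natCast_atTop_atTop.atTop_div_const (by norm_num)
    have h3 := (h.comp h2).const_mul 8
    rw [mul_zero] at h3
    refine h3.congr fun n => ?_
    simp only [Function.comp, pow_one]
    rw [neg_div]; ring
  have hk := kap_pos
  obtain ⟨N, hN⟩ := Filter.eventually_atTop.1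
    (hlim.eventually_lt_const (show (0:ℝ) < kap / 8 by linarith))
  refine ⟨kap, kap_pos, xi, xi_pos, kap / 2, by linarith, N + 1, ?_⟩
  intro n hn a ha h01
  have hn0 : 0 < n := by omega
  have hn' : (0:ℝ) < n := by exact_mod_cast hn0
  have hNn := hN n (by omega)
  have hsg : ∀ e : Fin n → Bool, ∀ i, |sg (e i)| ≤ 1 := fun e i => (sg_abs _).le
  have hbW : ∀ μ : Fin n → ℝ, (∀ i, |μ i| ≤ 1) → BddAbove (Set.range (Wn n μ)) :=
    fun μ hμ => ⟨1, by rintro _ ⟨β, rfl⟩; exact Wn_le μ hμ β⟩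
  have hR2 : ∀ μ : Fin n → ℝ, (∀ i, |μ i| ≤ 1) → ((⨆ β : ℝ, Wn n μ β)
      - ∫ y, (1 / (n:ℝ)) * ∑ i, μ i * a y i ∂(Measure.pi fun i => gaussianReal (μ i) 1)) ≤ 2 := by
    intro μ hμ
    have := pay_ge a ha h01 μ hμ
    have := ciSup_le (fun β => Wn_le μ hμ β)
    linarith
  by_contra! hcon
  set R : (Fin n → Bool) → ℝ := fun e => ((⨆ β : ℝ, Wn n (fun i => sg (e i)) β)
      - ∫ y, (1 / (n:ℝ)) * ∑ i, sg (e i) * a y i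
        ∂(Measure.pi fun i => gaussianReal (sg (e i)) 1)) with hRdef
  have hgood : ∀ e : Fin n → Bool, |dl e| ≤ 1 / 2 → R e ≤ kap / 2 / n := by
    intro e he
    refine le_trans ?_ hcon.le
    have hmem := FF_class (dl e) he
    rw [← Wn_sg hn0 e] at hmem
    refine le_ciSup_of_le ?_ ⟨fun i => sg (e i), hsg e, hmem⟩ le_rfl
    refine ⟨2, ?_⟩
    rintro _ ⟨μ, rfl⟩
    exact hR2 μ.1 μ.2.1
  have hlow : ∀ e : Fin n → Bool, (PhiR 1 - PhiR (-1)) / 2 + dl e * ((PhiR 1 + PhiR (-1)) / 2)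
      + kap * dl e ^ 2 ≤ ⨆ β : ℝ, Wn n (fun i => sg (e i)) β := by
    intro e
    refine le_trans ?_ (le_ciSup (hbW _ (hsg e)) (-dl e / 2))
    rw [Wn_sg hn0 e]
    refine le_trans (le_of_eq ?_) (FF_gain (dl e) (dl_abs hn0 e))
    simp only [FF, kap, sub_zero]
    ring
  have hsum : 2 ^ n * (kap / n) ≤ ∑ e, R e := by
    have h1 := Finset.sum_le_sum (fun e (_ : e ∈ Finset.univ) => hlow e)
    rw [Finset.sum_add_distrib, Finset.sum_add_distrib, ← Finset.sum_mul, ← Finset.mul_sum,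
      sum_dl, sum_dl_sq hn0] at h1
    simp only [Finset.sum_const, Finset.card_univ, Fintype.card_fun, Fintype.card_bool,
      Fintype.card_fin, nsmul_eq_mul] at h1
    push_cast at h1
    have h2 := bayes_sum hn0 a ha h01
    simp only [hRdef]
    rw [Finset.sum_sub_distrib]
    have : (2:ℝ) ^ n * (kap / n) = kap * (2 ^ n / n) := by ring
    linarith
  have hup : ∑ e, R e ≤ 2 ^ n * (kap / 2 / n) + 2 * (2 ^ n * (2 * Real.exp (-(n:ℝ) / 8))) := by
    have hp : ∀ e, R e ≤ kap / 2 / n + 2 * (if ¬ |dl e| ≤ 1 / 2 then (1:ℝ) else 0) := by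
      intro e
      have hpos : 0 < kap / 2 / n := by positivity
      split_ifs with h
      · linarith [hgood e h]
      · have := hR2 (fun i => sg (e i)) (hsg e)
        simp only [hRdef]
        linarith
    refine (Finset.sum_le_sum fun e _ => hp e).trans ?_
    rw [Finset.sum_add_distrib, ← Finset.mul_sum]
    have hb := bad_count hn0
    rw [Finset.card_filter] at hb
    push_cast at hb
    simp only [Finset.sum_const, Finset.card_univ, Fintype.card_fun, Fintype.card_bool,
      Fintype.card_fin, nsmul_eq_mul]
    push_cast
    linarith
  have h2 : (0:ℝ) < 2 ^ n := by positivity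
  have h3 : (2:ℝ) ^ n * (kap / n) ≤ 2 ^ n * (kap / 2 / n + 4 * Real.exp (-(n:ℝ) / 8)) := by
    linarith
  have h4 := le_of_mul_le_mul_left h3 h2
  have h5 : kap / n = 2 * (kap / 2 / n) := by ring
  have h6 : kap / 2 / n ≤ 4 * Real.exp (-(n:ℝ) / 8) := by linarith
  rw [div_le_iff₀ hn'] at h6
  linarith
end

section
/- Fix n ≥ 1, an index i ∈ {1,…,n}, variances σ₁,…,σ_n > 0, a cost K_i ∈ ℝ, and a measurable decision rule a : ℝ × ℝ^{n−1} → [0,1] for unit i, written a(y_i, y_{−i}). Suppose that for Lebesgue-almost every y_{−i} ∈ ℝ^{n−1}, the conditional size γ₀(y_{−i}) = ∫_ℝ a(y, y_{−i}) (1/σ_i) φ((y − K_i)/σ_i) dy lies strictly in (0, 1). Then there exists a measurable threshold function δ_i : ℝ^{n−1} → ℝ such that for every μ = (μ₁,…,μ_n) ∈ ℝⁿ, E_μ[(μ_i − K_i) a(Y_i, Y_{−i})] ≤ E_μ[(μ_i − K_i) · 1{Y_i > δ_i(Y_{−i})}], where Y₁,…,Y_n are independent with Y_j ~ N(μ_j,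 σ_j²). -/
open MeasureTheory ProbabilityTheory

lemma aux_tprod_ac {ι : Type*} {α : ι → Type*} [∀ i, MeasurableSpace (α i)]
    (μ ν : ∀ i, Measure (α i)) [∀ i, SigmaFinite (μ i)] [∀ i, SigmaFinite (ν i)]
    (h : ∀ i, μ i ≪ ν i) (l : List ι) : Measure.tprod l μ ≪ Measure.tprod l ν := by
  induction l with
  | nil => simp only [Measure.tprod_nil]; exact Measure.AbsolutelyContinuous.rfl
  | cons i l ih =>
    simp only [Measure.tprod_cons]
    exact (h i).prod ih

lemma aux_pi_ac {ι : Type*} [Fintype ι] {α : ι → Type*} [∀ i, MeasurableSpace (α i)]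
    (μ ν : ∀ i, Measure (α i)) [∀ i, SigmaFinite (μ i)] [∀ i, SigmaFinite (ν i)]
    (h : ∀ i, μ i ≪ ν i) : Measure.pi μ ≪ Measure.pi ν := by
  classical
  have := Fintype.toEncodable ι
  rw [← Measure.pi'_eq_pi μ, ← Measure.pi'_eq_pi ν]
  exact (aux_tprod_ac μ ν h _).map (measurable_tProd_elim' _)

lemma aux_np (K m : ℝ) (v : NNReal) (hv : v ≠ 0) (f : ℝ → ℝ) (hf : Measurable f)
    (hf01 : ∀ y, f y ∈ Set.Icc (0:ℝ) 1) (d : ℝ)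
    (h : ∫ y, f y ∂gaussianReal K v = ∫ y, (if d < y then (1:ℝ) else 0) ∂gaussianReal K v) :
    (m - K) * ∫ y, f y ∂gaussianReal m v
      ≤ (m - K) * ∫ y, (if d < y then (1:ℝ) else 0) ∂gaussianReal m v := by
  have hvpos : (0:ℝ) < v := by positivity
  set I : ℝ → ℝ := fun y => (if d < y then (1:ℝ) else 0) - f y with hI
  have hm1 : Measurable (fun y : ℝ => if d < y then (1:ℝ) else 0) :=
    Measurable.ite measurableSet_Ioi measurable_const measurable_const
  have hIm : Measurable I := hm1.sub hf
  have hf_int : ∀ c, Integrable f (gaussianReal c v) := fun c =>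
    Integrable.of_bound hf.aestronglyMeasurable 1 (Filter.Eventually.of_forall fun y => by
      rw [Real.norm_eq_abs, abs_le]; constructor <;> linarith [(hf01 y).1, (hf01 y).2])
  have h1_int : ∀ c, Integrable (fun y : ℝ => if d < y then (1:ℝ) else 0) (gaussianReal c v) :=
    fun c => Integrable.of_bound hm1.aestronglyMeasurable 1 (Filter.Eventually.of_forall fun y => by
      split_ifs <;> simp)
  have hIb : ∀ y, ‖I y‖ ≤ 1 := fun y => by
    rw [Real.norm_eq_abs, abs_le]; simp only [hI]
    split_ifs <;> constructor <;> linarith [(hf01 y).1, (hf01 y).2]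
  have hint : ∀ c, Integrable (fun y => gaussianPDFReal c v y * I y) := fun c =>
    (integrable_gaussianPDFReal c v).mul_bdd (c := 1) hIm.aestronglyMeasurable
      (Filter.Eventually.of_forall hIb)
  have hdiff : ∀ c, ∫ y, gaussianPDFReal c v y * I y
      = (∫ y, (if d < y then (1:ℝ) else 0) ∂gaussianReal c v) - ∫ y, f y ∂gaussianReal c v := by
    intro c
    rw [← integral_sub (h1_int c) (hf_int c), integral_gaussianReal_eq_integral_smul hv]
    rfl
  have hK : ∫ y, gaussianPDFReal K v y * I y = 0 := by rw [hdiff, h, sub_self]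
  set L := gaussianPDFReal m v d / gaussianPDFReal K v d with hL
  have hLpos : 0 < L := div_pos (gaussianPDFReal_pos _ _ _ hv) (gaussianPDFReal_pos _ _ _ hv)
  have hrel : ∀ y, gaussianPDFReal m v y
      = Real.exp ((m - K) * (y - d) / v) * L * gaussianPDFReal K v y := by
    intro y
    rw [hL, mul_div_assoc', div_mul_eq_mul_div, eq_div_iff (gaussianPDFReal_pos _ _ _ hv).ne']
    simp only [gaussianPDFReal]
    have : Real.exp (-(y - m) ^ 2 / (2 * v)) * Real.exp (-(d - K) ^ 2 / (2 * v))
        = Real.exp ((m - K) * (y - d) / v) * Real.exp (-(d - m) ^ 2 / (2 * v))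
          * Real.exp (-(y - K) ^ 2 / (2 * v)) := by
      rw [← Real.exp_add, ← Real.exp_add, ← Real.exp_add]
      congr 1
      field_simp
      ring
    linear_combination (√(2 * Real.pi * v))⁻¹ ^ 2 * this
  have hpt : ∀ y, 0 ≤ (m - K) * (gaussianPDFReal m v y * I y)
      - (m - K) * L * (gaussianPDFReal K v y * I y) := by
    intro y
    rw [hrel]
    have e : (m - K) * (Real.exp ((m - K) * (y - d) / v) * L * gaussianPDFReal K v y * I y)
      - (m - K) * L * (gaussianPDFReal K v y * I y)
      = (L * gaussianPDFReal K v y) *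
        ((m - K) * I y * (Real.exp ((m - K) * (y - d) / v) - 1)) := by ring
    rw [e]
    refine mul_nonneg (mul_nonneg hLpos.le (gaussianPDFReal_nonneg _ _ _)) ?_
    have hs : 0 ≤ (m - K) * I y ∧ 0 ≤ (m - K) * (y - d) / v ∨
        (m - K) * I y ≤ 0 ∧ (m - K) * (y - d) / v ≤ 0 := by
      have hI2 : (0 ≤ I y ∧ 0 ≤ y - d) ∨ (I y ≤ 0 ∧ y - d ≤ 0) := by
        simp only [hI]
        split_ifs with hc
        · left; constructor <;> linarith [(hf01 y).2]
        · right; constructor <;> linarith [(hf01 y).1]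
      rcases le_total 0 (m - K) with hmk | hmk <;> rcases hI2 with ⟨h1, h2⟩ | ⟨h1, h2⟩
      · exact Or.inl ⟨mul_nonneg hmk h1, div_nonneg (mul_nonneg hmk h2) hvpos.le⟩
      · exact Or.inr ⟨mul_nonpos_of_nonneg_of_nonpos hmk h1,
          div_nonpos_of_nonpos_of_nonneg (mul_nonpos_of_nonneg_of_nonpos hmk h2) hvpos.le⟩
      · exact Or.inr ⟨mul_nonpos_of_nonpos_of_nonneg hmk h1,
          div_nonpos_of_nonpos_of_nonneg (mul_nonpos_of_nonpos_of_nonneg hmk h2) hvpos.le⟩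
      · exact Or.inl ⟨mul_nonneg_of_nonpos_of_nonpos hmk h1,
          div_nonneg (mul_nonneg_of_nonpos_of_nonpos hmk h2) hvpos.le⟩
    rcases hs with ⟨h1, h2⟩ | ⟨h1, h2⟩
    · exact mul_nonneg h1 (by linarith [Real.one_le_exp h2])
    · exact mul_nonneg_of_nonpos_of_nonpos h1 (by linarith [Real.exp_le_one_iff.2 h2])
  have hfin := integral_nonneg (μ := volume) (f := fun y => (m - K) * (gaussianPDFReal m v y * I y)
      - (m - K) * L * (gaussianPDFReal K v y * I y)) hpt
  rw [integral_sub ((hint m).const_mul _) ((hint K).const_mul _), integral_const_mul,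
    integral_const_mul, hK, hdiff] at hfin
  linarith

lemma aux_cdf_strict (K : ℝ) (v : NNReal) (hv : v ≠ 0) : StrictMono (cdf (gaussianReal K v)) := by
  intro s t hst
  refine lt_of_le_of_ne (monotone_cdf _ hst.le) fun he => ?_
  have h0 : gaussianReal K v (Set.Ioc s t) = 0 := by
    rw [← measure_cdf (gaussianReal K v), StieltjesFunction.measure_Ioc, he]; simp
  have := gaussianReal_absolutelyContinuous' K hv h0
  simp at this
  linarith

lemma aux_cdf_cont (K : ℝ) (v : NNReal) (hv : v ≠ 0) : Continuous (cdf (gaussianReal K v)) := by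
  rw [continuous_iff_continuousAt]
  intro x
  rw [(monotone_cdf _).continuousAt_iff_leftLim_eq_rightLim, StieltjesFunction.rightLim_eq]
  have h0 : gaussianReal K v {x} = 0 := gaussianReal_absolutelyContinuous K hv (by simp)
  rw [← measure_cdf (gaussianReal K v), StieltjesFunction.measure_singleton] at h0
  have h1 := (monotone_cdf (gaussianReal K v)).leftLim_le (le_refl x)
  have h2 := ENNReal.ofReal_eq_zero.1 h0
  linarith

lemma aux_quant (K : ℝ) (v : NNReal) (hv : v ≠ 0) :
    ∃ h : ℝ → ℝ, Measurable h ∧ ∀ p ∈ Set.Ioo (0:ℝ) 1,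
      p = ∫ y, (if h p < y then (1:ℝ) else 0) ∂gaussianReal K v := by
  classical
  have hex : ∀ p ∈ Set.Ioo (0:ℝ) 1, ∃ t, cdf (gaussianReal K v) t = 1 - p := by
    intro p hp
    obtain ⟨b, hb⟩ := ((tendsto_cdf_atTop (gaussianReal K v)).eventually_const_lt
      (show 1 - p < 1 by linarith [hp.1])).exists
    obtain ⟨c, hc⟩ := ((tendsto_cdf_atBot (gaussianReal K v)).eventually_lt_const
      (show 0 < 1 - p by linarith [hp.2])).exists
    exact mem_range_of_exists_le_of_exists_ge (aux_cdf_cont K v hv) ⟨c, hc.le⟩ ⟨b, hb.le⟩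
  choose g hg using hex
  refine ⟨fun p => if hp : p ∈ Set.Ioo (0:ℝ) 1 then g p hp else 0, ?_, ?_⟩
  · refine measurable_of_Iic fun t => ?_
    have : (fun p => if hp : p ∈ Set.Ioo (0:ℝ) 1 then g p hp else 0) ⁻¹' Set.Iic t
        = (Set.Ioo 0 1 ∩ Set.Ici (1 - cdf (gaussianReal K v) t))
          ∪ ((Set.Ioo 0 1)ᶜ ∩ {_p | (0:ℝ) ≤ t}) := by
      ext p
      by_cases hp : p ∈ Set.Ioo (0:ℝ) 1
      · simp only [Set.mem_preimage, hp, dite_true, Set.mem_Iic, Set.mem_union, Set.mem_inter_iff,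
          true_and, Set.mem_compl_iff, not_true, false_and, or_false, Set.mem_Ici]
        rw [← (aux_cdf_strict K v hv).le_iff_le, hg p hp]
        constructor <;> intro h <;> linarith
      · simp only [Set.mem_preimage, hp, dite_false, Set.mem_Iic, Set.mem_union, Set.mem_inter_iff,
          false_and, Set.mem_compl_iff, not_false_eq_true, true_and, false_or, Set.mem_ofPred_eq]
    rw [this]
    exact (measurableSet_Ioo.inter measurableSet_Ici).union
      (measurableSet_Ioo.compl.inter (MeasurableSet.const _))
  · intro p hp
    simp only [hp, dite_true]
    have e : (fun y : ℝ => if g p hp < y then (1:ℝ) else 0)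
        = (Set.Ioi (g p hp)).indicator 1 := by
      ext y; simp [Set.indicator_apply]
    rw [e, integral_indicator_one measurableSet_Ioi, ← Set.compl_Iic,
      probReal_compl_eq_one_sub measurableSet_Iic, ← cdf_eq_real, hg p hp]
    ring

lemma aux_pdf (K s y : ℝ) (hs : 0 < s) :
    s⁻¹ * phiR ((y - K) / s) = gaussianPDFReal K ((s ^ 2).toNNReal) y := by
  simp only [phiR, gaussianPDFReal]
  rw [Real.coe_toNNReal _ (sq_nonneg s), Real.sqrt_mul (by positivity) (s ^ 2),
    Real.sqrt_sq hs.le, mul_inv]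
  have : -((y - K) / s) ^ 2 / 2 = -(y - K) ^ 2 / (2 * s ^ 2) := by
    field_simp
  rw [this]; ring

lemma aux_split (n : ℕ) (i : Fin n) (ν : Fin n → Measure ℝ) [∀ j, IsProbabilityMeasure (ν j)]
    (F : ℝ → ({j : Fin n // j ≠ i} → ℝ) → ℝ) (hF : Measurable (Function.uncurry F))
    (hF01 : ∀ y r, F y r ∈ Set.Icc (0:ℝ) 1) :
    ∫ y : Fin n → ℝ, F (y i) (fun j => y j.1) ∂(Measure.pi ν)
      = ∫ r, ∫ x, F x r ∂(ν i) ∂(Measure.pi fun j : {j : Fin n // j ≠ i} => ν j) := by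
  have h1 := measurePreserving_piEquivPiSubtypeProd ν (fun j => j = i)
  have h2 := (measurePreserving_piUnique (fun j : {j : Fin n // j = i} => ν j)).prod
    (MeasurePreserving.id (Measure.pi fun j : {j : Fin n // j ≠ i} => ν j))
  have h1' : MeasurePreserving (MeasurableEquiv.piEquivPiSubtypeProd (fun _ : Fin n => ℝ)
      (fun j => j = i)) (Measure.pi ν)
      ((@Measure.pi {j : Fin n // j = i} (fun _ => ℝ) (Fintype.subtypeEq i) _
        (fun j => ν j)).prod (Measure.pi fun j : {j : Fin n // j ≠ i} => ν j)) := by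
    convert h1
  have h3 := h2.comp h1'
  have h4 : ∫ y : Fin n → ℝ, F (y i) (fun j => y j.1) ∂(Measure.pi ν)
      = ∫ z, Function.uncurry F z
          ∂((ν i).prod (Measure.pi fun j : {j : Fin n // j ≠ i} => ν j)) := by
    have e := h3.map_eq
    change _ = ((ν i).prod (Measure.pi fun j : {j : Fin n // j ≠ i} => ν j)) at e
    rw [← e, integral_map h3.measurable.aemeasurable hF.aestronglyMeasurable]
    rfl
  rw [h4, integral_prod_symm]
  · rfl
  · exact Integrable.of_bound hF.aestronglyMeasurable 1 (Filter.Eventually.of_forall fun z => by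
      have := hF01 z.1 z.2
      rw [Real.norm_eq_abs, abs_le]
      constructor <;> simp only [Function.uncurry] <;> linarith [this.1, this.2])

/-- every randomized selection decision for unit `i` with nondegenerate
conditional size is weakly dominated, simultaneously in `μ`, by a threshold rule. -/
theorem reduction_to_threshold_rules (n : ℕ) (hn : 1 ≤ n) (i : Fin n)
    (σ : Fin n → ℝ) (hσ : ∀ j, 0 < σ j) (Ki : ℝ)
    (a : ℝ → ({j : Fin n // j ≠ i} → ℝ) → ℝ)
    (ha : Measurable (Function.uncurry a))
    (ha01 : ∀ y yrest, a y yrest ∈ Set.Icc (0:ℝ) 1)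
    (hsize : ∀ᵐ yrest ∂(volume : Measure ({j : Fin n // j ≠ i} → ℝ)),
      (∫ y : ℝ, a y yrest * ((σ i)⁻¹ * phiR ((y - Ki) / σ i))) ∈ Set.Ioo (0:ℝ) 1) :
    ∃ δ : ({j : Fin n // j ≠ i} → ℝ) → ℝ, Measurable δ ∧
      ∀ μ : Fin n → ℝ,
        (∫ y : Fin n → ℝ, (μ i - Ki) * a (y i) (fun j => y j.1)
            ∂(Measure.pi fun j => gaussianReal (μ j) ((σ j ^ 2).toNNReal)))
          ≤ ∫ y : Fin n → ℝ,
              (μ i - Ki) * (if δ (fun j => y j.1) < y i then 1 else 0)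
            ∂(Measure.pi fun j => gaussianReal (μ j) ((σ j ^ 2).toNNReal)) := by
  classical
  have hv : ∀ j, (σ j ^ 2).toNNReal ≠ 0 := fun j => by
    have := hσ j
    rw [Ne, Real.toNNReal_eq_zero, not_le]; positivity
  obtain ⟨h, hhm, hh⟩ := aux_quant Ki _ (hv i)
  set s : ({j : Fin n // j ≠ i} → ℝ) → ℝ :=
    fun r => ∫ y, a y r ∂gaussianReal Ki ((σ i ^ 2).toNNReal) with hs
  have hsm : Measurable s :=
    (StronglyMeasurable.integral_prod_left' (μ := gaussianReal Ki ((σ i ^ 2).toNNReal))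
      ha.stronglyMeasurable).measurable
  have hδm : Measurable (fun r => h (s r)) := hhm.comp hsm
  refine ⟨fun r => h (s r), hδm, fun μ => ?_⟩
  have hTm : Measurable (Function.uncurry
      (fun (x : ℝ) (r : {j : Fin n // j ≠ i} → ℝ) => if h (s r) < x then (1:ℝ) else 0)) :=
    Measurable.ite (measurableSet_lt (hδm.comp measurable_snd) measurable_fst)
      measurable_const measurable_const
  have hT01 : ∀ (x : ℝ) (r : {j : Fin n // j ≠ i} → ℝ),
      (if h (s r) < x then (1:ℝ) else 0) ∈ Set.Icc (0:ℝ) 1 := fun x r => by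
    split_ifs <;> simp
  rw [integral_const_mul, integral_const_mul,
    aux_split n i (fun j => gaussianReal (μ j) ((σ j ^ 2).toNNReal)) a ha ha01,
    aux_split n i (fun j => gaussianReal (μ j) ((σ j ^ 2).toNNReal)) _ hTm hT01,
    ← integral_const_mul, ← integral_const_mul]
  have hbi : ∀ F : ℝ → ({j : Fin n // j ≠ i} → ℝ) → ℝ, Measurable (Function.uncurry F) →
      (∀ y r, F y r ∈ Set.Icc (0:ℝ) 1) →
      Integrable (fun r => (μ i - Ki) * ∫ x, F x r ∂gaussianReal (μ i) ((σ i ^ 2).toNNReal))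
        (Measure.pi fun j : {j : Fin n // j ≠ i} =>
          gaussianReal (μ j) ((σ j ^ 2).toNNReal)) := by
    intro F hF hF01
    refine Integrable.const_mul (Integrable.of_bound (StronglyMeasurable.integral_prod_left'
      hF.stronglyMeasurable).aestronglyMeasurable 1 (Filter.Eventually.of_forall fun r => ?_)) _
    refine (norm_integral_le_of_norm_le_const (C := 1) (Filter.Eventually.of_forall fun x => ?_)).trans
      (by simp)
    have := hF01 x r
    rw [Real.norm_eq_abs, abs_le]
    constructor <;> simp only [Function.uncurry] <;> linarith [this.1, this.2]
  refine integral_mono_ae (hbi _ ha ha01) (hbi _ hTm hT01) ?_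
  have hac : (Measure.pi fun j : {j : Fin n // j ≠ i} =>
      gaussianReal (μ j) ((σ j ^ 2).toNNReal)) ≪ volume :=
    aux_pi_ac _ _ fun j => gaussianReal_absolutelyContinuous _ (hv j)
  filter_upwards [hac.ae_le hsize] with r hr
  refine aux_np Ki (μ i) _ (hv i) (fun y => a y r) (ha.comp measurable_prodMk_right)
    (fun y => ha01 y r) (h (s r)) ?_
  refine hh (s r) ?_
  have e : s r = ∫ y : ℝ, a y r * ((σ i)⁻¹ * phiR ((y - Ki) / σ i)) := by
    simp only [hs]
    rw [integral_gaussianReal_eq_integral_smul (hv i)]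
    congr 1
    ext y
    rw [aux_pdf _ _ _ (hσ i), smul_eq_mul, mul_comm]
  rw [e]; exact hr
end
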